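/- arXiv:2204.02463 — 6 statements merged into one kernel-verified Lean document; each statement's English description precedes it below -/
import Mathlib

section
/- If a group Γ acts by pretree automorphisms on a complete median pretree K and the action is non-nesting, then for any Γ-equivariant full relation ∼ on K, the induced action of Γ on the quotient pretree K/∼ is non-nesting. -/
open Set

universe u v w

namespace RelHypBoundary

/-! ### Pretrees -/

variable {K : Type*} {G : Type*}

/-- `btw x y z` means `y` is between `x` and `z`.  The open interval `(x,z)`. -/
def openInt (btw : K → K → K → Prop) (x z : K) : Set K := {y | btw x y z}

/-- The closed interval `[x,z]`. -/
def closedInt (btw : K → K → K → Prop) (x z : K) : Set K :=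
  openInt btw x z ∪ {x, z}

/-- A subset of a pretree is full if it contains the closed interval between
any two of its points. -/
def IsFull (btw : K → K → K → Prop) (A : Set K) : Prop :=
  ∀ x ∈ A, ∀ z ∈ A, closedInt btw x z ⊆ A

/-- The pretree axioms for a ternary betweenness relation `btw x y z`
("`y` is between `x` and `z`"). -/
structure IsPretree (btw : K → K → K → Prop) : Prop where
  ne_of_btw : ∀ {x y z : K}, btw x y z → x ≠ z
  symm : ∀ {x y z : K}, btw x y z → btw z y x
  asymm : ∀ {x y z : K}, btw x y z → ¬ btw x z y
  split : ∀ {x y z : K} (w : K), btw x y z → y ≠ w → btw x y w ∨ btw w y z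

/-- A median pretree: every triple of points has a median. -/
def IsMedianPretree (btw : K → K → K → Prop) : Prop :=
  ∀ x y z : K, ∃ m : K,
    m ∈ closedInt btw x y ∧ m ∈ closedInt btw y z ∧ m ∈ closedInt btw z x

/-- An arc: a nonempty full subset that is linearly ordered by betweenness. -/
def IsArc (btw : K → K → K → Prop) (A : Set K) : Prop :=
  A.Nonempty ∧ IsFull btw A ∧
    ∀ x ∈ A, ∀ y ∈ A, ∀ z ∈ A, x ≠ y → y ≠ z → x ≠ z →
      btw x y z ∨ btw y z x ∨ btw z x y

/-- `A` is an interval (open, half-open or closed). -/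
def IsIntervalSet (btw : K → K → K → Prop) (A : Set K) : Prop :=
  ∃ x z : K, A = openInt btw x z ∨ A = closedInt btw x z ∨
    A = insert x (openInt btw x z) ∨ A = insert z (openInt btw x z)

/-- A pretree is complete if every arc is an interval. -/
def IsCompletePretree (btw : K → K → K → Prop) : Prop :=
  ∀ A : Set K, IsArc btw A → IsIntervalSet btw A

/-- A pretree is interval complete if every arc contained in an interval is an interval. -/
def IsIntervalComplete (btw : K → K → K → Prop) : Prop :=
  ∀ A : Set K, IsArc btw A → (∃ x z : K, A ⊆ closedInt btw x z) → IsIntervalSet btw A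

/-- The interior of a pretree: the set of non-terminal points. -/
def pretreeInterior (btw : K → K → K → Prop) : Set K :=
  {y | ∃ x z : K, btw x y z}

/-- Two points are adjacent if they are distinct and the open interval between
them is empty. -/
def AdjacentP (btw : K → K → K → Prop) (x z : K) : Prop :=
  x ≠ z ∧ ∀ y : K, ¬ btw x y z

/-- A map preserves betweenness. -/
def PreservesBtw (btw : K → K → K → Prop) (f : K → K) : Prop :=
  ∀ x y z : K, btw x y z ↔ btw (f x) (f y) (f z)

/-- A pretree automorphism: a betweenness-preserving bijection. -/
def IsPretreeAuto (btw : K → K → K → Prop) (e : K ≃ K) : Prop :=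
  ∀ x y z : K, btw x y z ↔ btw (e x) (e y) (e z)

/-- A group action (given by `act`) on a pretree is non-nesting if no group
element maps a closed interval properly into itself. -/
def NonNesting (btw : K → K → K → Prop) (act : G → K → K) : Prop :=
  ∀ (g : G) (x z : K), ¬ (act g '' closedInt btw x z ⊂ closedInt btw x z)

/-- Non-nesting for the restricted action on a subpretree `S` (intervals of the
subpretree are intervals of the ambient pretree intersected with `S`). -/
def NonNestingOn (btw : K → K → K → Prop) (S : Set K) (act : G → K → K) : Prop :=
  ∀ (g : G) (x z : K), x ∈ S → z ∈ S →
    ¬ (act g '' (closedInt btw x z ∩ S) ⊂ closedInt btw x z ∩ S)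

/-- `p` is a connector point of the ordered pair `(Y, X)`. -/
def IsConnector (btw : K → K → K → Prop) (Y X : Set K) (p : K) : Prop :=
  p ∈ Y ∧ ∀ x ∈ X, closedInt btw x p ∩ Y = {p}

/-- A full relation: an equivalence relation all of whose classes are full. -/
def IsFullRelation (btw : K → K → K → Prop) (s : Setoid K) : Prop :=
  ∀ x y : K, s.r x y → ∀ z ∈ closedInt btw x y, s.r x z

/-- The induced betweenness on the quotient by a full relation: `Y` lies between
`X` and `Z` iff some `y₀ ∈ Y` lies between every `x ∈ X` and every `z ∈ Z`. -/
def quotBtw (btw : K → K → K → Prop) (s : Setoid K) :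
    Quotient s → Quotient s → Quotient s → Prop := fun X Y Z =>
  ∃ y₀ : K, Quotient.mk s y₀ = Y ∧
    ∀ x z : K, Quotient.mk s x = X → Quotient.mk s z = Z → btw x y₀ z

/-- Quotient betweenness expressed on representatives, for an arbitrary
relation `r`: the class of `y` lies between the class of `x` and the class of
`z`. -/
def qBtw (btw : K → K → K → Prop) (r : K → K → Prop) (x y z : K) : Prop :=
  ∃ y₀ : K, r y y₀ ∧ ∀ x' z' : K, r x x' → r z z' → btw x' y₀ z'

/-- The induced betweenness on the quotient `Quot r`. -/
def quotBtwQ (btw : K → K → K → Prop) (r : K → K → Prop) :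
    Quot r → Quot r → Quot r → Prop := fun X Y Z =>
  ∃ x y z : K, Quot.mk r x = X ∧ Quot.mk r y = Y ∧ Quot.mk r z = Z ∧ qBtw btw r x y z

/-- The transfinite sequence of relations `∼_α` on a pretree `K`:
`∼₀` is equality; `∼_{α+1}` identifies `x, y` whenever the closed interval
between their classes in `K_α = K/∼_α` contains only finitely many classes;
at limits one takes the union. -/
noncomputable def relSeq (btw : K → K → K → Prop) (α : Ordinal.{v}) : K → K → Prop :=
  Ordinal.limitRecOn α (· = ·)
    (fun _ r => fun x y => ∃ S : Set K, S.Finite ∧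
      ∀ w : K, (qBtw btw r x w y ∨ r w x ∨ r w y) → ∃ s ∈ S, r w s)
    (fun α _ ih => fun x y => ∃ β : Ordinal, ∃ h : β < α, ih β h x y)

/-! ### Continua and cut points -/

variable {M : Type u} [TopologicalSpace M]

/-- A cut point of a connected space: a point whose complement is disconnected. -/
def IsCutPoint (M : Type u) [TopologicalSpace M] (c : M) : Prop :=
  ¬ IsPreconnected ({c}ᶜ : Set M)

/-- `c` is between `a` and `b` relative to the family `C` of cut points:
`c ∈ C` and the complement of `c` is a disjoint union of open sets separating
`a` from `b`. -/
def mBtw (C : Set M) (a c b : M) : Prop :=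
  c ∈ C ∧ ∃ U V : Set M, IsOpen U ∧ IsOpen V ∧ U ∩ V = ∅ ∧
    U ∪ V = ({c}ᶜ : Set M) ∧ a ∈ U ∧ b ∈ V

/-- The equivalence relation on `M` dual to `C`: each `c ∈ C` is equivalent only
to itself, and points of `M \ C` are equivalent iff no point separates them. -/
def cpRel (C : Set M) (a b : M) : Prop :=
  a = b ∨ (a ∉ C ∧ b ∉ C ∧ ¬ ∃ c : M, mBtw C a c b)

/-- The equivalence class of a point. -/
def CPClass (C : Set M) (a : M) : Set M := {b | cpRel C a b}

/-- The underlying set of the cut point pretree of `M` dual to `C`: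
the set of equivalence classes. -/
def CutPretree (M : Type u) [TopologicalSpace M] (C : Set M) : Type u :=
  {A : Set M // ∃ a : M, A = CPClass C a}

/-- Betweenness for (underlying sets of) classes: `z` is between `x` and `y`. -/
def kBtwSet (C : Set M) (x z y : Set M) : Prop :=
  (∃ c ∈ C, z = {c} ∧ ∀ a ∈ x, ∀ b ∈ y, mBtw C a c b) ∨
  ((∀ c ∈ z, c ∉ C) ∧ ∀ a ∈ x, ∀ b ∈ y, ∀ c ∈ z,
      insert a {t : M | mBtw C a t c} ∩ insert b {t : M | mBtw C c t b} = (∅ : Set M))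

/-- The betweenness relation of the cut point pretree of `M` dual to `C`. -/
def kBtw (M : Type u) [TopologicalSpace M] (C : Set M) :
    CutPretree M C → CutPretree M C → CutPretree M C → Prop :=
  fun x z y => kBtwSet C x.1 z.1 y.1

/-- The relation `≈` defining the dendrite quotient `D(M,C)`: `x ≈ y` iff the
set of points of `C` between `x` and `y` contains no subset order-isomorphic
to `ℚ`. -/
def dRel (C : Set M) (x y : M) : Prop :=
  ¬ ∃ f : ℚ → M, (∀ q : ℚ, f q ∈ C ∧ mBtw C x (f q) y) ∧
    ∀ q q' : ℚ, q < q' → mBtw C x (f q) (f q')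

/-! ### Dynamics -/

/-- The set of ordered distinct triples. -/
def DistinctTriples (M : Type u) : Set (M × M × M) :=
  {p | p.1 ≠ p.2.1 ∧ p.1 ≠ p.2.2 ∧ p.2.1 ≠ p.2.2}

/-- The diagonal action of a map on triples. -/
def tripleMap (f : M → M) : M × M × M → M × M × M :=
  fun p => (f p.1, f p.2.1, f p.2.2)

variable {Γ : Type w} [Group Γ]

/-- A convergence group action: `M` has at least three points, each element
acts as a homeomorphism (continuously), and the induced action on the space of
distinct triples is properly discontinuous. -/
def IsConvergenceAction {M : Type u} [TopologicalSpace M] (act : Γ → M → M) : Prop :=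
  (∃ a b c : M, a ≠ b ∧ a ≠ c ∧ b ≠ c) ∧
  (∀ g : Γ, Continuous (act g)) ∧
  (∀ L : Set (M × M × M), L ⊆ DistinctTriples M → IsCompact L →
    {g : Γ | (tripleMap (act g) '' L ∩ L).Nonempty}.Finite)

/-- A minimal action: no proper nonempty closed invariant subset. -/
def IsMinimalAction {M : Type u} [TopologicalSpace M] (act : Γ → M → M) : Prop :=
  ∀ A : Set M, IsClosed A → A.Nonempty → (∀ g : Γ, act g '' A ⊆ A) → A = Set.univ

/-- A parabolic point: fixed by some infinite subgroup that fixes no other point. -/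
def IsParabolicPoint {M : Type u} (act : Γ → M → M) (p : M) : Prop :=
  ∃ H : Subgroup Γ, (H : Set Γ).Infinite ∧ (∀ h ∈ H, act h p = p) ∧
    ∀ q : M, (∀ h ∈ H, act h q = q) → q = p

/-- An elementary subset of a convergence group: finite, or preserving setwise
a nonempty subset of `M` with at most two points. -/
def IsElementarySubset {M : Type u} (act : Γ → M → M) (S : Set Γ) : Prop :=
  S.Finite ∨ ∃ A : Set M, A.Nonempty ∧ (∃ a b : M, A ⊆ {a, b}) ∧ ∀ g ∈ S, act g '' A = A

/-- `Γ` splits relative to `PP` over torsion subgroups: `Γ` acts by graph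
automorphisms on a simplicial tree, without inversions, with no global fixed
vertex, with torsion edge stabilizers, and with each member of `PP` fixing a
vertex. -/
def SplitsOverTorsionRel (Γ : Type w) [Group Γ] (PP : Set (Subgroup Γ)) : Prop :=
  ∃ (V : Type w) (T : SimpleGraph V) (act : Γ →* Equiv.Perm V),
    T.IsTree ∧
    (∀ (g : Γ) (u v : V), T.Adj u v → T.Adj (act g u) (act g v)) ∧
    (∀ (g : Γ) (u v : V), T.Adj u v → ¬ (act g u = v ∧ act g v = u)) ∧
    (¬ ∃ v : V, ∀ g : Γ, act g v = v) ∧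
    (∀ u v : V, T.Adj u v → ∀ g : Γ, act g u = u → act g v = v → IsOfFinOrder g) ∧
    (∀ P ∈ PP, ∃ v : V, ∀ g ∈ P, act g v = v)

/-- A null family: for each open cover, all but finitely many members of the
family are contained in a single member of the cover. -/
def NullFamily (X : Type u) [TopologicalSpace X] (𝒞 : Set (Set X)) : Prop :=
  ∀ 𝒰 : Set (Set X), (∀ U ∈ 𝒰, IsOpen U) → ⋃₀ 𝒰 = Set.univ →
    {A ∈ 𝒞 | ¬ ∃ U ∈ 𝒰, A ⊆ U}.Finite

end RelHypBoundary

open RelHypBoundary Set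

namespace RelHypBoundary

section Pretree

variable {K : Type*} {btw : K → K → K → Prop}

theorem mem_closedInt_iff {x y z : K} : y ∈ closedInt btw x z ↔ btw x y z ∨ y = x ∨ y = z :=
  Iff.rfl

theorem closedInt_comm (h : IsPretree btw) (x z : K) : closedInt btw x z = closedInt btw z x := by
  ext y
  simp only [mem_closedInt_iff]
  grind [h.symm (x := x) (y := y) (z := z), h.symm (x := z) (y := y) (z := x)]

theorem left_mem_closedInt (x z : K) : x ∈ closedInt btw x z := Or.inr (Or.inl rfl)

theorem right_mem_closedInt (x z : K) : z ∈ closedInt btw x z := Or.inr (Or.inr rfl)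

namespace IsPretree

theorem ne_left (h : IsPretree btw) {x y z : K} (hb : btw x y z) : y ≠ x := by
  rintro rfl
  exact h.asymm (h.symm hb) (h.symm hb)

theorem ne_right (h : IsPretree btw) {x y z : K} (hb : btw x y z) : y ≠ z := by
  rintro rfl
  exact h.asymm hb hb

/-- Two collinear triples overlapping in their middle segment combine. -/
theorem chain (h : IsPretree btw) {a b c d : K} (h₁ : btw a b c) (h₂ : btw b c d) :
    btw a b d ∧ btw a c d := by
  obtain ⟨h1, h2, h3, h4⟩ := h
  grind

/-- A collinear triple nested inside a segment of another one. -/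
theorem nest (h : IsPretree btw) {a b c d : K} (h₁ : btw a b d) (h₂ : btw b c d) :
    btw a b c ∧ btw a c d := by
  have hab : btw a b c := by
    have h3 := h.split c h₁ (h.ne_left h₂).symm
    exact h3.resolve_right fun hb => h.asymm (h.symm hb) (h.symm h₂)
  exact ⟨hab, (h.chain hab h₂).2⟩

theorem isFull_closedInt (h : IsPretree btw) (p q : K) : IsFull btw (closedInt btw p q) := by
  intro x hx z hz y hy
  simp only [mem_closedInt_iff] at *
  obtain ⟨h1, h2, h3, h4⟩ := h
  grind

theorem collinear_of_mem_closedInt (h : IsPretree btw) {p q x y z : K}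
    (hx : x ∈ closedInt btw p q) (hy : y ∈ closedInt btw p q) (hz : z ∈ closedInt btw p q)
    (hxy : x ≠ y) (hyz : y ≠ z) (hxz : x ≠ z) :
    btw x y z ∨ btw y z x ∨ btw z x y := by
  simp only [mem_closedInt_iff] at *
  obtain ⟨h1, h2, h3, h4⟩ := h
  grind

end IsPretree

/-- A sequence of points running monotonically along an arc. -/
def IsMonotoneSeq (btw : K → K → K → Prop) (u : ℕ → K) : Prop :=
  ∀ i j k : ℕ, i < j → j < k → btw (u i) (u j) (u k)

/-- A bound of a monotone sequence `u` which no point of `(u 0, e)` improves. -/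
structure IsSeqLimit (btw : K → K → K → Prop) (u : ℕ → K) (e : K) : Prop where
  btw_end : ∀ i j : ℕ, i < j → btw (u i) (u j) e
  exists_btw : ∀ y, btw (u 0) y e → ∃ n, ∀ m, n ≤ m → btw (u 0) y (u m)

theorem IsPretree.isMonotoneSeq_of_step (h : IsPretree btw) {u : ℕ → K}
    (hu : ∀ n, btw (u n) (u (n + 1)) (u (n + 2))) : IsMonotoneSeq btw u := by
  have key : ∀ i d, btw (u i) (u (i + d + 1)) (u (i + d + 2)) := by
    intro i d
    induction d with
    | zero => exact hu i
    | succ d ih => exact (h.chain ih (hu (i + d + 1))).2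
  intro i j k hij hjk
  obtain ⟨d, rfl⟩ := Nat.exists_eq_add_of_lt hij
  obtain ⟨l, rfl⟩ := Nat.exists_eq_add_of_lt hjk
  induction l with
  | zero => exact key i d
  | succ l ih =>
    have h1 := ih (by omega)
    have h2 : btw (u i) (u (i + d + 1 + l + 1)) (u (i + d + 1 + l + 2)) := by
      have := key i (d + 1 + l)
      simpa only [← add_assoc] using this
    exact h.symm (h.nest (h.symm h2) (h.symm h1)).2

theorem IsPretree.isSeqLimit_unique (h : IsPretree btw) (hMed : IsMedianPretree btw) {u : ℕ → K}
    {e e' : K} (he : IsSeqLimit btw u e) (he' : IsSeqLimit btw u e') : e = e' := by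
  by_contra hne
  obtain ⟨m, hm1, hm2, hm3⟩ := hMed (u 0) e e'
  have not_between : ∀ {a b}, IsSeqLimit btw u a → IsSeqLimit btw u b → ¬ btw (u 0) a b := by
    intro a b ha hb hab
    obtain ⟨n, hn⟩ := hb.exists_btw a hab
    exact h.asymm (hn (n + 1) (by omega)) (ha.btw_end 0 (n + 1) (by omega))
  have h01 := he.btw_end 0 1 one_pos
  have h01' := he'.btw_end 0 1 one_pos
  have ne0 := h.ne_of_btw h01
  have ne0' := h.ne_of_btw h01'
  have hme : m ≠ e := by
    rintro rfl
    rcases hm3 with hm3 | hm3 | hm3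
    · exact not_between he he' (h.symm hm3)
    · exact hne hm3
    · exact ne0 hm3.symm
  have hme' : m ≠ e' := by
    rintro rfl
    rcases hm1 with hm1 | hm1 | hm1
    · exact not_between he' he hm1
    · exact ne0' hm1.symm
    · exact hne hm1.symm
  have hm2 : btw e m e' := hm2.resolve_right (by rintro (hm | hm) <;> contradiction)
  -- some point of the sequence lies strictly beyond `m`
  obtain ⟨n, hn, hn'⟩ : ∃ n, btw m (u n) e ∧ btw m (u n) e' := by
    by_cases hm0 : m = u 0
    · subst hm0
      exact ⟨1, h01, h01'⟩
    · have hm1 : btw (u 0) m e :=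
        hm1.resolve_right (by rintro (hm | hm) <;> contradiction)
      have hm3 : btw (u 0) m e' :=
        h.symm (hm3.resolve_right (by rintro (hm | hm) <;> contradiction))
      obtain ⟨n, hn⟩ := he.exists_btw m hm1
      have := hn (n + 1) (by omega)
      exact ⟨n + 1, h.symm (h.nest (h.symm (he.btw_end 0 (n + 1) (by omega))) (h.symm this)).1,
        h.symm (h.nest (h.symm (he'.btw_end 0 (n + 1) (by omega))) (h.symm this)).1⟩
  exact h.asymm (h.nest hm2 hn').1 (h.symm hn)

/-- In a complete pretree every monotone sequence has a limit. -/
theorem IsPretree.exists_isSeqLimit (h : IsPretree btw) (hComp : IsCompletePretree btw)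
    {u : ℕ → K} (hu : IsMonotoneSeq btw u) : ∃ e, IsSeqLimit btw u e := by
  set A : Set K := ⋃ n, closedInt btw (u 0) (u n)
  have hmono : Monotone fun n => closedInt btw (u 0) (u n) := by
    refine monotone_nat_of_le_succ fun n => ?_
    refine h.isFull_closedInt _ _ _ (left_mem_closedInt _ _) _ ?_
    rcases Nat.eq_zero_or_pos n with rfl | hn
    · exact left_mem_closedInt _ _
    · exact Or.inl (hu 0 n (n + 1) hn (by omega))
  have huA : ∀ n, u n ∈ A := fun n => mem_iUnion.2 ⟨n, right_mem_closedInt _ _⟩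
  have hArc : IsArc btw A := by
    refine ⟨⟨u 0, huA 0⟩, ?_, ?_⟩
    · intro x hx z hz y hy
      obtain ⟨n, hx⟩ := mem_iUnion.1 hx
      obtain ⟨k, hz⟩ := mem_iUnion.1 hz
      exact mem_iUnion.2 ⟨max n k, h.isFull_closedInt _ _ _ (hmono (le_max_left n k) hx) _
        (hmono (le_max_right n k) hz) hy⟩
    · intro x hx y hy z hz
      obtain ⟨n, hx⟩ := mem_iUnion.1 hx
      obtain ⟨k, hy⟩ := mem_iUnion.1 hy
      obtain ⟨l, hz⟩ := mem_iUnion.1 hz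
      exact h.collinear_of_mem_closedInt (hmono (show n ≤ max n (max k l) by omega) hx)
        (hmono (show k ≤ max n (max k l) by omega) hy)
        (hmono (show l ≤ max n (max k l) by omega) hz)
  obtain ⟨p, q, hAsub, hsubA⟩ : ∃ p q, A ⊆ closedInt btw p q ∧ openInt btw p q ⊆ A := by
    obtain ⟨p, q, hpq⟩ := hComp A hArc
    refine ⟨p, q, fun y hy => ?_, fun y hy => ?_⟩
    · rcases hpq with hpq | hpq | hpq | hpq <;> rw [hpq] at hy
      · exact Or.inl hy
      · exact hy
      · exact hy.elim (fun hp => Or.inr (Or.inl hp)) Or.inl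
      · exact hy.elim (fun hq => Or.inr (Or.inr hq)) Or.inl
    · rcases hpq with hpq | hpq | hpq | hpq <;> rw [hpq]
      · exact hy
      · exact Or.inl hy
      · exact Or.inr hy
      · exact Or.inr hy
  -- one of the two endpoints lies beyond `u 1`
  obtain ⟨p, e, hAsub, hsubA, h01⟩ : ∃ p e, A ⊆ closedInt btw p e ∧ openInt btw p e ⊆ A ∧
      btw (u 0) (u 1) e := by
    have h012 := hu 0 1 2 (by omega) (by omega)
    have hp : btw p (u 1) q := by
      have h0 := hAsub (huA 0)
      have h1 := hAsub (huA 1)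
      have h2 := hAsub (huA 2)
      simp only [mem_closedInt_iff] at h0 h1 h2
      obtain ⟨h1, h2, h3, h4⟩ := h
      grind
    rcases h.split (u 0) hp (h.ne_left h012) with hp | hp
    · exact ⟨q, p, closedInt_comm h p q ▸ hAsub, fun y hy => hsubA (h.symm hy), h.symm hp⟩
    · exact ⟨p, q, hAsub, hsubA, hp⟩
  have h0 : ∀ n, 0 < n → btw (u 0) (u n) e := by
    intro n hn
    rcases Nat.lt_or_ge 1 n with hn1 | hn1
    · have h1n := hu 0 1 n (by omega) hn1
      have h1n' := hu 0 n (n + 1) (by omega) (by omega)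
      have m0 := hAsub (huA 0)
      have m1 := hAsub (huA n)
      have m2 := hAsub (huA (n + 1))
      simp only [mem_closedInt_iff] at m0 m1 m2
      obtain ⟨h1, h2, h3, h4⟩ := h
      grind
    · obtain rfl : n = 1 := by omega
      exact h01
  refine ⟨e, ⟨fun i j hij => ?_, fun y hy => ?_⟩⟩
  · rcases Nat.eq_zero_or_pos i with rfl | hi
    · exact h0 j hij
    · exact h.symm (h.nest (h.symm (h0 j (by omega))) (h.symm (hu 0 i j hi hij))).1
  · have hyA : y ∈ A := by
      refine hsubA ?_
      have m0 := hAsub (huA 0)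
      rcases m0 with m0 | m0 | m0
      · exact (h.nest m0 hy).2
      · exact m0 ▸ hy
      · exact absurd m0 (h.ne_of_btw hy)
    obtain ⟨n, hn⟩ := mem_iUnion.1 hyA
    refine ⟨n + 1, fun m hm => ?_⟩
    rcases hn with hn | hn | hn
    · rcases Nat.eq_zero_or_pos n with rfl | hn0
      · exact absurd hn fun hb => h.ne_of_btw hb rfl
      · exact h.symm (h.nest (h.symm (hu 0 n m hn0 (by omega))) (h.symm hn)).2
    · exact absurd hn (h.ne_left hy)
    · rcases Nat.eq_zero_or_pos n with rfl | hn0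
      · exact absurd hn (h.ne_left hy)
      · exact hn ▸ hu 0 n m hn0 (by omega)

theorem image_closedInt_of_preservesBtw {f : K → K} (hf : Function.Bijective f)
    (hb : PreservesBtw btw f) (x z : K) :
    f '' closedInt btw x z = closedInt btw (f x) (f z) := by
  ext y
  obtain ⟨y, rfl⟩ := hf.2 y
  rw [hf.1.mem_set_image]
  simp only [mem_closedInt_iff, hf.1.eq_iff]
  rw [hb x y z]

/-- The limit of a monotone orbit would be the endpoint of a nested interval. -/
theorem not_btw_iterate (h : IsPretree btw) (hComp : IsCompletePretree btw)
    (hMed : IsMedianPretree btw) {f : K → K} (hf : Function.Bijective f)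
    (hb : PreservesBtw btw f)
    (hNN : ∀ x z, ¬ f '' closedInt btw x z ⊂ closedInt btw x z) (c : K) :
    ¬ btw c (f c) (f (f c)) := by
  intro hc
  set u : ℕ → K := fun n => f^[n] c
  have hsucc : ∀ n, u (n + 1) = f (u n) := fun n => Function.iterate_succ_apply' f n c
  have hstep : ∀ n, btw (u n) (u (n + 1)) (u (n + 2)) := by
    intro n
    induction n with
    | zero => exact hc
    | succ n ih =>
      rw [hb, ← hsucc, ← hsucc, ← hsucc] at ih
      exact ih
  have hu := h.isMonotoneSeq_of_step hstep
  obtain ⟨e, he⟩ := h.exists_isSeqLimit hComp hu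
  have h1 : IsSeqLimit btw (fun n => u (n + 1)) e := by
    refine ⟨fun i j hij => he.btw_end _ _ (by omega), fun y hy => ?_⟩
    obtain ⟨n, hn⟩ := he.exists_btw y (h.nest (he.btw_end 0 1 one_pos) hy).2
    refine ⟨n, fun m hm => ?_⟩
    have h2 := hn (m + 1) (by omega)
    have h3 := (h.nest (he.btw_end 0 1 one_pos) hy).1
    exact h.symm (h.nest (h.symm h2) (h.symm h3)).1
  have h2 : IsSeqLimit btw (fun n => u (n + 1)) (f e) := by
    refine ⟨fun i j hij => ?_, fun y hy => ?_⟩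
    · rw [hsucc, hsucc, ← hb]
      exact he.btw_end i j hij
    · obtain ⟨y, rfl⟩ := hf.2 y
      simp only [hsucc] at hy ⊢
      obtain ⟨n, hn⟩ := he.exists_btw y ((hb _ _ _).2 hy)
      exact ⟨n, fun m hm => (hb _ _ _).1 (hn m hm)⟩
  have hfe : f e = e := h.isSeqLimit_unique hMed h2 h1
  have h01 := he.btw_end 0 1 one_pos
  refine hNN (u 0) e ?_
  rw [image_closedInt_of_preservesBtw hf hb, hfe, ← hsucc]
  refine ⟨h.isFull_closedInt _ _ _ (Or.inl h01) _ (right_mem_closedInt _ _), fun hsub => ?_⟩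
  rcases hsub (left_mem_closedInt (u 0) e) with h3 | h3 | h3
  · exact h.asymm (h.symm h3) (h.symm h01)
  · exact h.ne_left h01 h3.symm
  · exact h.ne_of_btw h01 h3

theorem not_btw_image_of_not_btw_iterate (h : IsPretree btw) {f : K → K}
    (hf : Function.Bijective f) (hb : PreservesBtw btw f)
    (h1 : ∀ c, ¬ btw c (f c) (f (f c))) {x z : K} (hx : f x ∈ closedInt btw x z) :
    ¬ btw x (f x) (f z) := by
  intro hxz
  have hfx : f (f x) ∈ closedInt btw (f x) (f z) := by
    rw [← image_closedInt_of_preservesBtw hf hb]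
    exact mem_image_of_mem f hx
  rcases hfx with hfx | hfx | hfx
  · exact h1 x (h.nest hxz hfx).1
  · rw [hf.1 hfx] at hxz
    exact h.ne_left hxz rfl
  · exact h1 x (hfx ▸ hxz)

/-- If neither an automorphism nor its square translates a point, then it does not nest
intervals. -/
theorem not_image_closedInt_ssubset (h : IsPretree btw) {f : K → K}
    (hf : Function.Bijective f) (hb : PreservesBtw btw f)
    (h1 : ∀ c, ¬ btw c (f c) (f (f c)))
    (h2 : ∀ c, ¬ btw c (f (f c)) (f (f (f (f c))))) (x z : K) :
    ¬ f '' closedInt btw x z ⊂ closedInt btw x z := by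
  intro hss
  have hb2 : PreservesBtw btw (f ∘ f) := fun x y z => (hb x y z).trans (hb _ _ _)
  have hf2 := hf.comp hf
  have hss2 : (f ∘ f) '' closedInt btw x z ⊂ closedInt btw x z := by
    rw [image_comp]
    exact (image_mono hss.1).trans_ssubset hss
  have hx := hss.1 (mem_image_of_mem f (left_mem_closedInt x z))
  have hz := hss.1 (mem_image_of_mem f (right_mem_closedInt x z))
  have hx2 := hss2.1 (mem_image_of_mem (f ∘ f) (left_mem_closedInt x z))
  have hz2 := hss2.1 (mem_image_of_mem (f ∘ f) (right_mem_closedInt x z))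
  have hx' := image_mono (f := f) hss.1
    (mem_image_of_mem f (mem_image_of_mem f (left_mem_closedInt x z)))
  have hz' := image_mono (f := f) hss.1
    (mem_image_of_mem f (mem_image_of_mem f (right_mem_closedInt x z)))
  have A := not_btw_image_of_not_btw_iterate h hf hb h1 hx
  have B := not_btw_image_of_not_btw_iterate h hf hb h1 (closedInt_comm h x z ▸ hz)
  have A2 := not_btw_image_of_not_btw_iterate h hf2 hb2 h2 hx2
  have B2 := not_btw_image_of_not_btw_iterate h hf2 hb2 h2 (closedInt_comm h x z ▸ hz2)
  have hne : ¬ (f x = x ∧ f z = z) := by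
    rintro ⟨hfx, hfz⟩
    refine hss.ne ?_
    rw [image_closedInt_of_preservesBtw hf hb, hfx, hfz]
  have hne2 : ¬ ((f ∘ f) x = x ∧ (f ∘ f) z = z) := by
    rintro ⟨hfx, hfz⟩
    refine hss2.ne ?_
    rw [image_closedInt_of_preservesBtw hf2 hb2, hfx, hfz]
  rw [image_closedInt_of_preservesBtw hf hb] at hx' hz'
  have hxz : x ≠ z := by
    rintro rfl
    rcases hx with hfx | hfx | hfx
    · exact h.ne_of_btw hfx rfl
    · exact hne ⟨hfx, hfx⟩
    · exact hne ⟨hfx, hfx⟩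
  have i1 : f x ≠ f z := hf.1.ne hxz
  have i2 : f (f x) ≠ f (f z) := hf.1.ne i1
  -- the automorphism reverses the interval
  have hzx : f z ∈ closedInt btw x (f x) ∧ f x ∈ closedInt btw (f z) z := by
    clear hx' hz' A2 B2 hx2 hz2 hss hss2 hb hb2 hf hf2 hne2 i2 h1 h2
    simp only [mem_closedInt_iff] at *
    obtain ⟨h1, h2, h3, h4⟩ := h
    grind
  have hzx2 : f (f z) ∈ closedInt btw (f x) (f (f x)) ∧
      f (f x) ∈ closedInt btw (f (f z)) (f z) := by
    rw [← image_closedInt_of_preservesBtw hf hb, ← image_closedInt_of_preservesBtw hf hb]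
    exact ⟨mem_image_of_mem f hzx.1, mem_image_of_mem f hzx.2⟩
  clear hx hz hss hss2 hb hb2 hf hf2 h1 h2 A B hne
  simp only [mem_closedInt_iff, Function.comp_apply] at *
  obtain ⟨h1, h2, h3, h4⟩ := h
  grind

end Pretree

section Quotient

variable {K : Type*} {btw : K → K → K → Prop} {s : Setoid K}

/-- Betweenness of a point outside two classes depends only on these classes. -/
theorem IsFullRelation.btw_of_btw (h : IsPretree btw) (hfull : IsFullRelation btw s)
    {x y z x' z' : K} (hxy : ¬ s.r x y) (hzy : ¬ s.r z y) (hb : btw x y z)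
    (hx : s.r x x') (hz : s.r z z') : btw x' y z' := by
  have key : ∀ {a a' b : K}, ¬ s.r a y → s.r a a' → btw a y b → btw a' y b := by
    intro a a' b hay haa' hb
    have hne : y ≠ a' := by
      rintro rfl
      exact hay haa'
    exact (h.split a' hb hne).resolve_left fun hb' => hay (hfull a a' haa' y (Or.inl hb'))
  exact h.symm (key hzy hz (h.symm (key hxy hx hb)))

theorem IsPretree.quotBtw (h : IsPretree btw) (hfull : IsFullRelation btw s) :
    IsPretree (quotBtw btw s) where
  ne_of_btw := by
    rintro X Y Z ⟨y, -, hy⟩ rfl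
    obtain ⟨x, rfl⟩ := Quotient.exists_rep X
    exact h.ne_of_btw (hy x x rfl rfl) rfl
  symm := by
    rintro X Y Z ⟨y, hY, hy⟩
    exact ⟨y, hY, fun x z hx hz => h.symm (hy z x hz hx)⟩
  asymm := by
    rintro X Y Z ⟨y, hY, hy⟩ ⟨z, hZ, hz⟩
    obtain ⟨x, hX⟩ := Quotient.exists_rep X
    exact h.asymm (hy x z hX hZ) (hz x y hX hY)
  split := by
    rintro X Y Z W ⟨y, hY, hy⟩ hYW
    obtain ⟨x, hX⟩ := Quotient.exists_rep X
    obtain ⟨z, hZ⟩ := Quotient.exists_rep Z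
    obtain ⟨w, hW⟩ := Quotient.exists_rep W
    have hxy : ¬ s.r x y := fun hr =>
      h.ne_left (hy y z ((Quotient.sound hr).symm.trans hX) hZ) rfl
    have hzy : ¬ s.r z y := fun hr =>
      h.ne_right (hy x y hX ((Quotient.sound hr).symm.trans hZ)) rfl
    have hwy : ¬ s.r w y := fun hr => hYW (hY.symm.trans ((Quotient.sound hr).symm.trans hW))
    have hyw : y ≠ w := by
      rintro rfl
      exact hwy (s.refl y)
    rcases h.split w (hy x z hX hZ) hyw with hb | hb
    · exact Or.inl ⟨y, hY, fun x' w' hx' hw' => hfull.btw_of_btw h hxy hwy hb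
        (Quotient.exact (hX.trans hx'.symm)) (Quotient.exact (hW.trans hw'.symm))⟩
    · exact Or.inr ⟨y, hY, fun w' z' hw' hz' => hfull.btw_of_btw h hwy hzy hb
        (Quotient.exact (hW.trans hw'.symm)) (Quotient.exact (hZ.trans hz'.symm))⟩

variable {f : K → K} {F : Quotient s → Quotient s}

theorem preservesBtw_quotBtw (hf : Function.Surjective f) (hF : Function.Injective F)
    (hfF : ∀ x, F (Quotient.mk s x) = Quotient.mk s (f x)) (hb : PreservesBtw btw f) :
    PreservesBtw (quotBtw btw s) F := by
  intro X Y Z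
  constructor
  · rintro ⟨y, rfl, hy⟩
    refine ⟨f y, (hfF y).symm, fun x z hx hz => ?_⟩
    obtain ⟨x, rfl⟩ := hf x
    obtain ⟨z, rfl⟩ := hf z
    rw [← hfF] at hx hz
    exact (hb _ _ _).1 (hy x z (hF hx) (hF hz))
  · rintro ⟨y, hY, hy⟩
    obtain ⟨y, rfl⟩ := hf y
    rw [← hfF] at hY
    refine ⟨y, hF hY, ?_⟩
    rintro x z rfl rfl
    exact (hb _ _ _).2 (hy _ _ (hfF x).symm (hfF z).symm)

theorem exists_btw_iterate_of_quotBtw (hf : Function.Surjective f) (hF : Function.Injective F)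
    (hfF : ∀ x, F (Quotient.mk s x) = Quotient.mk s (f x)) {W : Quotient s}
    (hW : quotBtw btw s W (F W) (F (F W))) : ∃ c, btw c (f c) (f (f c)) := by
  obtain ⟨y, hy, hb⟩ := hW
  obtain ⟨c, rfl⟩ := hf y
  rw [← hfF] at hy
  obtain rfl := hF hy
  exact ⟨c, hb c (f (f c)) rfl (by rw [hfF, hfF])⟩

end Quotient

end RelHypBoundary

/-- If a group `G` acts by pretree automorphisms on a complete
median pretree `K` and the action is non-nesting, then for any `G`-equivariant
full relation `∼` on `K`, the induced action of `G` on the quotient pretree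
`K/∼` is non-nesting. -/
theorem nonNesting_quotient {K : Type*} {G : Type*} [Group G]
    (btw : K → K → K → Prop) (hPre : IsPretree btw)
    (hComp : IsCompletePretree btw) (hMed : IsMedianPretree btw)
    (act : G → K → K)
    (hact_one : ∀ x : K, act 1 x = x)
    (hact_mul : ∀ (g h : G) (x : K), act (g * h) x = act g (act h x))
    (hauto : ∀ g : G, Function.Bijective (act g) ∧ PreservesBtw btw (act g))
    (hNN : NonNesting btw act)
    (s : Setoid K) (hfull : IsFullRelation btw s)
    (hequiv : ∀ (g : G) (x y : K), s.r x y → s.r (act g x) (act g y))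
    (qact : G → Quotient s → Quotient s)
    (hqact : ∀ (g : G) (x : K), qact g (Quotient.mk s x) = Quotient.mk s (act g x)) :
    NonNesting (quotBtw btw s) qact := by
  have hmul : ∀ (g h : G) (X : Quotient s), qact (g * h) X = qact g (qact h X) := by
    intro g h X
    obtain ⟨x, rfl⟩ := Quotient.exists_rep X
    simp only [hqact, hact_mul]
  have hone : ∀ X : Quotient s, qact 1 X = X := by
    intro X
    obtain ⟨x, rfl⟩ := Quotient.exists_rep X
    rw [hqact, hact_one]
  have hbij : ∀ g : G, Function.Bijective (qact g) := fun g =>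
    Function.bijective_iff_has_inverse.2 ⟨qact g⁻¹,
      fun X => by rw [← hmul, inv_mul_cancel, hone], fun X => by rw [← hmul, mul_inv_cancel, hone]⟩
  have hno : ∀ (g : G) (W : Quotient s), ¬ quotBtw btw s W (qact g W) (qact g (qact g W)) := by
    intro g W hW
    obtain ⟨c, hc⟩ := exists_btw_iterate_of_quotBtw (hauto g).1.2 (hbij g).1 (hqact g) hW
    exact not_btw_iterate hPre hComp hMed (hauto g).1 (hauto g).2 (hNN g) c hc
  intro g
  refine not_image_closedInt_ssubset (hPre.quotBtw hfull) (hbij g)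
    (preservesBtw_quotBtw (hauto g).1.2 (hbij g).1 (hqact g) (hauto g).2) (hno g) fun W => ?_
  simpa only [hmul] using hno (g * g) W
end

section
/- Let X be a compact Hausdorff space and let 𝒞 be a null family of closed, pairwise disjoint subsets of X. Then the quotient space X/𝒞, obtained by collapsing each member of 𝒞 to a point, is Hausdorff. -/
open Set

universe u v w

open RelHypBoundary Set

/-- The image of a compact Hausdorff space under a continuous closed surjection is Hausdorff. -/
theorem IsClosedMap.t2Space_of_surjective {X Y : Type*} [TopologicalSpace X] [TopologicalSpace Y]
    [CompactSpace X] [T2Space X] {f : X → Y} (hf : IsClosedMap f) (hc : Continuous f)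
    (hs : Function.Surjective f) : T2Space Y := by
  have hfiber (p : Y) : IsClosed (f ⁻¹' {p}) := by
    obtain ⟨x, rfl⟩ := hs p
    rw [← image_singleton]
    exact (hf _ isClosed_singleton).preimage hc
  refine ⟨fun p q hpq => ?_⟩
  have hd : Disjoint (f ⁻¹' {p}) (f ⁻¹' {q}) :=
    (disjoint_singleton.2 hpq).preimage f
  obtain ⟨U, V, hU, hV, hpU, hqV, hUV⟩ := normal_separation (hfiber p) (hfiber q) hd
  refine ⟨(f '' Uᶜ)ᶜ, (f '' Vᶜ)ᶜ, (hf _ hU.isClosed_compl).isOpen_compl,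
    (hf _ hV.isClosed_compl).isOpen_compl, ?_, ?_, ?_⟩
  · rintro ⟨x, hx, hxp⟩
    exact hx (hpU hxp)
  · rintro ⟨x, hx, hxq⟩
    exact hx (hqV hxq)
  · rw [Set.disjoint_left]
    intro y hyU hyV
    obtain ⟨x, rfl⟩ := hs y
    have hxU : x ∈ U := by
      by_contra h
      exact hyU ⟨x, h, rfl⟩
    have hxV : x ∈ V := by
      by_contra h
      exact hyV ⟨x, h, rfl⟩
    exact Set.disjoint_left.1 hUV hxU hxV

/-- In a regular space, the union of a closed set `F` with all the members of a null family of
closed sets that meet `F` is closed. -/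
theorem RelHypBoundary.NullFamily.isClosed_saturation {X : Type*} [TopologicalSpace X]
    [RegularSpace X] {𝒞 : Set (Set X)} (hnull : NullFamily X 𝒞) (hcl : ∀ A ∈ 𝒞, IsClosed A)
    {F : Set X} (hF : IsClosed F) : IsClosed (F ∪ ⋃₀ {A ∈ 𝒞 | (A ∩ F).Nonempty}) := by
  rw [← isOpen_compl_iff, isOpen_iff_mem_nhds]
  intro x hx
  rw [mem_compl_iff, mem_union, not_or] at hx
  obtain ⟨hxF, hxS⟩ := hx
  obtain ⟨W, hWx, hWcl, hWF⟩ := exists_mem_nhds_isClosed_subset (hF.isOpen_compl.mem_nhds hxF)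
  have hfin := hnull {Fᶜ, Wᶜ}
    (by
      rintro U (rfl | rfl)
      exacts [hF.isOpen_compl, hWcl.isOpen_compl])
    (by
      rw [sUnion_pair, ← compl_inter, compl_univ_iff]
      exact disjoint_iff_inter_eq_empty.1 (subset_compl_iff_disjoint_left.1 hWF))
  set 𝒟 := {A ∈ 𝒞 | ¬ ∃ U ∈ ({Fᶜ, Wᶜ} : Set (Set X)), A ⊆ U}
  have hBcl : IsClosed (⋃₀ {A ∈ 𝒟 | x ∉ A}) := by
    rw [sUnion_eq_biUnion]
    exact (hfin.subset (sep_subset _ _)).isClosed_biUnion fun A hA => hcl A hA.1.1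
  have hxB : x ∉ ⋃₀ {A ∈ 𝒟 | x ∉ A} := fun ⟨A, hA, hxA⟩ => hA.2 hxA
  filter_upwards [hWx, hBcl.isOpen_compl.mem_nhds hxB] with y hyW hyB
  rintro (hyF | ⟨A, ⟨hA, z, hzA, hzF⟩, hyA⟩)
  · exact hWF hyW hyF
  · refine hyB ⟨A, ⟨⟨hA, ?_⟩, fun hxA => hxS ⟨A, ⟨hA, z, hzA, hzF⟩, hxA⟩⟩, hyA⟩
    rintro ⟨U, rfl | rfl, hAU⟩
    exacts [hAU hzA hzF, hAU hyA hyW]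

/-- Collapsing the members of a pairwise disjoint family is an equivalence relation. -/
theorem equivalence_collapse {X : Type*} {𝒞 : Set (Set X)}
    (hdisj : ∀ A ∈ 𝒞, ∀ B ∈ 𝒞, A ≠ B → A ∩ B = ∅) :
    Equivalence (fun x y : X => x = y ∨ ∃ A ∈ 𝒞, x ∈ A ∧ y ∈ A) where
  refl _ := Or.inl rfl
  symm := by
    rintro x y (rfl | ⟨A, hA, hx, hy⟩)
    exacts [Or.inl rfl, Or.inr ⟨A, hA, hy, hx⟩]
  trans := by
    rintro x y z (rfl | ⟨A, hA, hx, hy⟩) (rfl | ⟨B, hB, hy', hz⟩)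
    · exact Or.inl rfl
    · exact Or.inr ⟨B, hB, hy', hz⟩
    · exact Or.inr ⟨A, hA, hx, hy⟩
    · obtain rfl : A = B := by
        by_contra h
        exact (hdisj A hA B hB h).subset ⟨hy, hy'⟩
      exact Or.inr ⟨A, hA, hx, hz⟩

/-- If `𝒞` is a null family of closed, pairwise disjoint
subsets of a compact Hausdorff space `X`, then the quotient `X/𝒞` obtained by
collapsing each member of `𝒞` to a point is Hausdorff. -/
theorem quotient_null_family_t2 {X : Type*} [TopologicalSpace X]
    [CompactSpace X] [T2Space X]
    (𝒞 : Set (Set X)) (hcl : ∀ A ∈ 𝒞, IsClosed A)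
    (hdisj : ∀ A ∈ 𝒞, ∀ B ∈ 𝒞, A ≠ B → A ∩ B = ∅)
    (hnull : NullFamily X 𝒞) :
    T2Space (Quot (fun x y : X => x = y ∨ ∃ A ∈ 𝒞, x ∈ A ∧ y ∈ A)) := by
  refine IsClosedMap.t2Space_of_surjective (fun F hF => ?_) continuous_quot_mk Quot.mk_surjective
  rw [← isQuotientMap_quot_mk.isClosed_preimage]
  convert hnull.isClosed_saturation hcl hF using 1
  ext y
  simp only [mem_preimage, mem_image, (equivalence_collapse hdisj).quot_mk_eq_iff]
  constructor
  · rintro ⟨x, hx, rfl | ⟨A, hA, hxA, hyA⟩⟩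
    exacts [Or.inl hx, Or.inr ⟨A, ⟨hA, x, hxA, hx⟩, hyA⟩]
  · rintro (hy | ⟨A, ⟨hA, x, hxA, hx⟩, hyA⟩)
    exacts [⟨y, hy, Or.inl rfl⟩, ⟨x, hx, Or.inr ⟨A, hA, hxA, hyA⟩⟩]
end

section
/- Let X be a compact Hausdorff space, let 𝒞 be a null family of closed, pairwise disjoint subsets of X, and let 𝒞̂ be the partition of X consisting of the members of 𝒞 together with the singletons {x} for points x contained in no member of 𝒞. Then for every open set U ⊆ X, the union U* of all members of 𝒞̂ contained in U is an open set. -/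
open Set

universe u v w

open RelHypBoundary Set

/-- Let `𝒞` be a null family of closed, pairwise disjoint
subsets of a compact Hausdorff space `X`, and let `𝒞̂` be the induced partition
of `X` (members of `𝒞` together with singletons of points in no member of
`𝒞`).  Then for every open `U ⊆ X`, the union `U*` of all members of `𝒞̂`
contained in `U` is open. -/
theorem saturation_open {X : Type*} [TopologicalSpace X]
    [CompactSpace X] [T2Space X]
    (𝒞 : Set (Set X)) (hcl : ∀ A ∈ 𝒞, IsClosed A)
    (hdisj : ∀ A ∈ 𝒞, ∀ B ∈ 𝒞, A ≠ B → A ∩ B = ∅)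
    (hnull : NullFamily X 𝒞)
    (U : Set X) (hU : IsOpen U) :
    IsOpen (⋃₀ {A : Set X |
      (A ∈ 𝒞 ∨ ∃ x : X, x ∉ ⋃₀ 𝒞 ∧ A = {x}) ∧ A ⊆ U}) := by
  rw [isOpen_iff_mem_nhds]
  rintro x ⟨A, ⟨hA, hAU⟩, hxA⟩
  obtain ⟨K, hK, hKcl, hKU⟩ := exists_mem_nhds_isClosed_subset (hU.mem_nhds (hAU hxA))
  have hfin := hnull {U, Kᶜ}
    (by
      rintro V (rfl | rfl)
      exacts [hU, hKcl.isOpen_compl])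
    (by
      rw [sUnion_pair, eq_univ_iff_forall]
      intro y
      by_cases hy : y ∈ K
      exacts [Or.inl (hKU hy), Or.inr hy])
  have hexc : IsClosed (⋃₀ {B ∈ 𝒞 | ¬ ∃ V ∈ ({U, Kᶜ} : Set (Set X)), B ⊆ V}) :=
    sUnion_eq_biUnion ▸ hfin.isClosed_biUnion fun B hB => hcl B hB.1
  have hx : x ∉ ⋃₀ {B ∈ 𝒞 | ¬ ∃ V ∈ ({U, Kᶜ} : Set (Set X)), B ⊆ V} := by
    rintro ⟨B, ⟨hB, hBV⟩, hxB⟩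
    rcases hA with hA | ⟨z, hz, rfl⟩
    · have hAB : A ≠ B := by
        rintro rfl
        exact hBV ⟨U, Or.inl rfl, hAU⟩
      exact (hdisj A hA B hB hAB).subset ⟨hxA, hxB⟩
    · rw [mem_singleton_iff] at hxA
      exact hz ⟨B, hB, hxA ▸ hxB⟩
  filter_upwards [hK, hexc.isOpen_compl.mem_nhds hx] with y hyK hy
  by_cases hyC : y ∈ ⋃₀ 𝒞
  · obtain ⟨B, hB, hyB⟩ := hyC
    refine ⟨B, ⟨Or.inl hB, ?_⟩, hyB⟩
    by_contra hBU
    refine hy ⟨B, ⟨hB, ?_⟩, hyB⟩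
    rintro ⟨V, rfl | rfl, hBV⟩
    exacts [hBU hBV, hBV hyB hyK]
  · exact ⟨{y}, ⟨Or.inr ⟨y, hyC, rfl⟩, singleton_subset_iff.2 (hKU hyK)⟩, rfl⟩
end

section
/- Let (X_i, f_{ij}) be an inverse system of nonempty compact Hausdorff spaces over a directed index set in which every bonding map f_{ij} is monotone (continuous, surjective, and with every fiber compact and connected). If every factor space X_i is locally connected, then the inverse limit of the system is locally connected. -/
open Set

universe u v w

open RelHypBoundary Set

theorem IsPreconnected.preimage_of_isClosedMap_of_fibers {α β : Type*} [TopologicalSpace α]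
    [TopologicalSpace β] {g : α → β} {s : Set β} (hs : IsPreconnected s) (hg : IsClosedMap g)
    (hsg : s ⊆ range g) (hfib : ∀ y ∈ s, IsPreconnected (g ⁻¹' {y})) :
    IsPreconnected (g ⁻¹' s) := by
  refine isPreconnected_closed_iff.mpr fun u v hu hv huv hsu hsv => ?_
  have hcover : s ⊆ g '' u ∪ g '' v := by
    rw [← image_union, ← image_preimage_eq_of_subset hsg]
    exact image_mono huv
  obtain ⟨_, hys, ⟨a, hau, rfl⟩, b, hbv, hb⟩ :=
    isPreconnected_closed_iff.mp hs _ _ (hg u hu) (hg v hv) hcover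
      (by simpa only [image_preimage_inter] using hsu.image g)
      (by simpa only [image_preimage_inter] using hsv.image g)
  have hsub : g ⁻¹' {g a} ⊆ g ⁻¹' s := preimage_mono (singleton_subset_iff.mpr hys)
  exact (isPreconnected_closed_iff.mp (hfib _ hys) u v hu hv (hsub.trans huv)
    ⟨a, rfl, hau⟩ ⟨b, hb, hbv⟩).mono (inter_subset_inter_left _ hsub)

section Threads

variable {I : Type*} [Preorder I] {X : I → Type*} {f : ∀ i j : I, i ≤ j → X j → X i}

/-- The threads of an inverse system, i.e. the points of its inverse limit. -/
abbrev Threads (f : ∀ i j : I, i ≤ j → X j → X i) : Type _ :=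
  {x : ∀ i, X i // ∀ (i j : I) (h : i ≤ j), f i j h (x j) = x i}

/-- The projection of the inverse limit to a factor. -/
def Threads.proj (i : I) (x : Threads f) : X i := x.1 i

variable [∀ i, TopologicalSpace (X i)]

theorem Threads.continuous_proj (i : I) : Continuous (Threads.proj (f := f) i) :=
  (continuous_apply i).comp continuous_subtype_val

theorem Threads.compactSpace [∀ i, CompactSpace (X i)] [∀ i, T2Space (X i)]
    (hcont : ∀ (i j : I) (h : i ≤ j), Continuous (f i j h)) : CompactSpace (Threads f) := by
  refine isCompact_iff_compactSpace.mp
    (IsClosed.isCompact (s := {x : ∀ i, X i | ∀ (i j : I) (h : i ≤ j), f i j h (x j) = x i}) ?_)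
  simp only [ofPred_forall]
  exact isClosed_iInter fun i => isClosed_iInter fun j => isClosed_iInter fun h =>
    isClosed_eq ((hcont i j h).comp (continuous_apply j)) (continuous_apply i)

theorem Threads.surjective_proj [IsDirected I (· ≤ ·)]
    [∀ i, CompactSpace (X i)] [∀ i, T2Space (X i)] [∀ i, Nonempty (X i)]
    (hcont : ∀ (i j : I) (h : i ≤ j), Continuous (f i j h))
    (hid : ∀ (i : I) (x : X i), f i i le_rfl x = x)
    (hcomp : ∀ (i j k : I) (hij : i ≤ j) (hjk : j ≤ k) (x : X k),
      f i j hij (f j k hjk x) = f i k (le_trans hij hjk) x)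
    (hsurj : ∀ (i j : I) (h : i ≤ j), Function.Surjective (f i j h)) (j : I) :
    Function.Surjective (Threads.proj (f := f) j) := by
  classical
  intro y
  let C : {k // j ≤ k} → Set (∀ i, X i) := fun k =>
    {x | x j = y ∧ ∀ (l : I) (h : l ≤ k.1), f l k.1 h (x k.1) = x l}
  have hclosed : ∀ k, IsClosed (C k) := fun k => by
    simp only [C, ofPred_and]
    refine (isClosed_eq (continuous_apply j) continuous_const).inter ?_
    simp only [ofPred_forall]
    exact isClosed_iInter fun l => isClosed_iInter fun h =>
      isClosed_eq ((hcont l k.1 h).comp (continuous_apply k.1)) (continuous_apply l)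
  have hmono : ∀ k m : {k // j ≤ k}, k.1 ≤ m.1 → C m ⊆ C k := by
    rintro k m hkm x ⟨hx, hxm⟩
    refine ⟨hx, fun l h => ?_⟩
    rw [← hxm k.1 hkm, hcomp, hxm]
  have hdir : Directed (· ⊇ ·) C := fun k k' => by
    obtain ⟨m, hkm, hkm'⟩ := exists_ge_ge k.1 k'.1
    exact ⟨⟨m, k.2.trans hkm⟩, hmono _ _ hkm, hmono _ _ hkm'⟩
  have hne : ∀ k, (C k).Nonempty := by
    rintro ⟨k, hk⟩
    obtain ⟨z, rfl⟩ := hsurj j k hk y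
    refine ⟨fun l => if h : l ≤ k then f l k h z else Classical.arbitrary _, ?_, fun l h => ?_⟩
    · simp [hk]
    · simp [h, hid]
  have : Nonempty {k // j ≤ k} := ⟨⟨j, le_rfl⟩⟩
  obtain ⟨x, hx⟩ := IsCompact.nonempty_iInter_of_directed_nonempty_isCompact_isClosed C hdir hne
    (fun k => (hclosed k).isCompact) hclosed
  rw [mem_iInter] at hx
  refine ⟨⟨x, fun l m h => ?_⟩, (hx ⟨j, le_rfl⟩).1⟩
  obtain ⟨k, hjk, hmk⟩ := exists_ge_ge j m
  have hxk := (hx ⟨k, hjk⟩).2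
  rw [← hxk m hmk, hcomp, hxk]

theorem Threads.exists_disjoint_image_proj [IsDirected I (· ≤ ·)] [∀ i, T2Space (X i)]
    {A B : Set (Threads f)} (hA : IsCompact A) (hB : IsCompact B) (hAB : Disjoint A B) (i : I) :
    ∃ j, i ≤ j ∧ Disjoint (Threads.proj j '' A) (Threads.proj j '' B) := by
  let U : {j // i ≤ j} → Set (Threads f × Threads f) := fun j =>
    {p | Threads.proj j.1 p.1 ≠ Threads.proj j.1 p.2}
  have hopen : ∀ j, IsOpen (U j) := fun j =>
    isOpen_ne_fun ((Threads.continuous_proj j.1).comp continuous_fst)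
      ((Threads.continuous_proj j.1).comp continuous_snd)
  have hmono : ∀ k m : I, k ≤ m → ∀ a b : Threads f,
      Threads.proj m a = Threads.proj m b → Threads.proj k a = Threads.proj k b := by
    intro k m h a b hab
    simp only [Threads.proj] at hab ⊢
    rw [← a.2 k m h, ← b.2 k m h, hab]
  have hdir : Directed (· ⊆ ·) U := fun k k' => by
    obtain ⟨m, hkm, hkm'⟩ := exists_ge_ge k.1 k'.1
    exact ⟨⟨m, k.2.trans hkm⟩, fun p hp h => hp (hmono _ _ hkm _ _ h),
      fun p hp h => hp (hmono _ _ hkm' _ _ h)⟩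
  have hcover : A ×ˢ B ⊆ ⋃ j, U j := by
    rintro ⟨a, b⟩ ⟨ha, hb⟩
    by_contra hab
    simp only [mem_iUnion, not_exists] at hab
    refine hAB.ne_of_mem ha hb (Subtype.ext (funext fun k => ?_))
    obtain ⟨m, him, hkm⟩ := exists_ge_ge i k
    exact hmono k m hkm a b (not_not.mp (hab ⟨m, him⟩))
  have : Nonempty {j // i ≤ j} := ⟨⟨i, le_rfl⟩⟩
  obtain ⟨j, hj⟩ := (hA.prod hB).elim_directed_cover U hopen hcover hdir
  refine ⟨j.1, j.2, disjoint_left.mpr ?_⟩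
  rintro _ ⟨a, ha, rfl⟩ ⟨b, hb, hab⟩
  exact hj (mk_mem_prod ha hb) hab.symm

theorem Threads.isPreconnected_proj_fiber [IsDirected I (· ≤ ·)]
    [∀ i, T2Space (X i)] [CompactSpace (Threads f)]
    (hproj : ∀ i, Function.Surjective (Threads.proj (f := f) i))
    (hfiber : ∀ (i j : I) (h : i ≤ j) (y : X i), IsPreconnected (f i j h ⁻¹' {y}))
    (i : I) (y : X i) : IsPreconnected (Threads.proj (f := f) i ⁻¹' {y}) := by
  have hclosed : IsClosed (Threads.proj (f := f) i ⁻¹' {y}) :=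
    isClosed_singleton.preimage (Threads.continuous_proj i)
  rw [isPreconnected_iff_subset_of_fully_disjoint_closed hclosed]
  intro A B hA hB hcover hAB
  obtain ⟨j, hij, hdisj⟩ :=
    Threads.exists_disjoint_image_proj hA.isCompact hB.isCompact hAB i
  have himage : ∀ {S : Set (Threads f)}, IsClosed S → IsClosed (Threads.proj j '' S) :=
    fun hS => (hS.isCompact.image (Threads.continuous_proj j)).isClosed
  have hsub : f i j hij ⁻¹' {y} ⊆ Threads.proj j '' A ∪ Threads.proj j '' B := by
    intro z hz
    obtain ⟨x, rfl⟩ := hproj j z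
    rw [← image_union]
    exact mem_image_of_mem _ (hcover ((x.2 i j hij).symm.trans hz))
  have hmem : ∀ x ∈ Threads.proj (f := f) i ⁻¹' {y}, Threads.proj j x ∈ f i j hij ⁻¹' {y} :=
    fun x hx => (x.2 i j hij).trans hx
  refine (isPreconnected_iff_subset_of_disjoint_closed.mp (hfiber i j hij y) _ _
    (himage hA) (himage hB) hsub (by rw [hdisj.inter_eq, inter_empty])).imp ?_ ?_
  · intro h x hx
    exact (hcover hx).resolve_right fun hxB =>
      hdisj.ne_of_mem (h (hmem x hx)) (mem_image_of_mem _ hxB) rfl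
  · intro h x hx
    exact (hcover hx).resolve_left fun hxA =>
      hdisj.ne_of_mem (mem_image_of_mem _ hxA) (h (hmem x hx)) rfl

theorem Threads.exists_preimage_proj_subset [IsDirected I (· ≤ ·)] [Nonempty I]
    (hcont : ∀ (i j : I) (h : i ≤ j), Continuous (f i j h))
    {x : Threads f} {U : Set (Threads f)} (hU : U ∈ nhds x) :
    ∃ i, ∃ V ∈ nhds (Threads.proj i x), Threads.proj i ⁻¹' V ⊆ U := by
  have hdir : Directed (· ≥ ·) fun i =>
      Filter.comap (Threads.proj (f := f) i) (nhds (Threads.proj i x)) := by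
    refine directed_of_isDirected_le fun i j hij => ?_
    have hij' : Threads.proj (f := f) i = f i j hij ∘ Threads.proj j :=
      funext fun z => (z.2 i j hij).symm
    rw [ge_iff_le, hij', ← Filter.comap_comap]
    exact Filter.comap_mono ((hcont i j hij).tendsto _).le_comap
  rw [nhds_subtype_eq_comap, nhds_pi, Filter.pi, Filter.comap_iInf] at hU
  simp only [Filter.comap_comap] at hU
  exact (Filter.mem_iInf_of_directed hdir U).mp hU

end Threads

/-- **Capel.** The inverse limit of an inverse system of nonempty
compact Hausdorff locally connected spaces over a directed index set with
monotone bonding maps is locally connected. -/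
theorem locallyConnected_inverse_limit {I : Type*} [Preorder I]
    [IsDirected I (· ≤ ·)]
    (X : I → Type*) [∀ i, TopologicalSpace (X i)]
    [∀ i, CompactSpace (X i)] [∀ i, T2Space (X i)] [∀ i, Nonempty (X i)]
    [∀ i, LocallyConnectedSpace (X i)]
    (f : ∀ i j : I, i ≤ j → X j → X i)
    (hcont : ∀ (i j : I) (h : i ≤ j), Continuous (f i j h))
    (hid : ∀ (i : I) (x : X i), f i i le_rfl x = x)
    (hcomp : ∀ (i j k : I) (hij : i ≤ j) (hjk : j ≤ k) (x : X k),
      f i j hij (f j k hjk x) = f i k (le_trans hij hjk) x)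
    (hsurj : ∀ (i j : I) (h : i ≤ j), Function.Surjective (f i j h))
    (hfiber : ∀ (i j : I) (h : i ≤ j) (y : X i),
      IsCompact (f i j h ⁻¹' {y}) ∧ IsConnected (f i j h ⁻¹' {y})) :
    LocallyConnectedSpace
      {x : ∀ i, X i // ∀ (i j : I) (h : i ≤ j), f i j h (x j) = x i} := by
  rcases isEmpty_or_nonempty I with hI | hI
  · exact inferInstanceAs (LocallyConnectedSpace (Threads f))
  have : CompactSpace (Threads f) := Threads.compactSpace hcont
  have hproj := Threads.surjective_proj hcont hid hcomp hsurj
  refine locallyConnectedSpace_iff_connected_subsets.mpr fun x U hU => ?_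
  obtain ⟨i, V, hV, hVU⟩ := Threads.exists_preimage_proj_subset hcont hU
  obtain ⟨W, hW, hWpre, hWV⟩ := locallyConnectedSpace_iff_connected_subsets.mp inferInstance _ V hV
  refine ⟨Threads.proj i ⁻¹' W, (Threads.continuous_proj i).continuousAt hW, ?_,
    (preimage_mono hWV).trans hVU⟩
  exact hWpre.preimage_of_isClosedMap_of_fibers (Threads.continuous_proj i).isClosedMap
    (by simp [(hproj i).range_eq])
    fun y _ => Threads.isPreconnected_proj_fiber hproj
      (fun i j h y => (hfiber i j h y).2.isPreconnected) i y
end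

section
/- Let M be a continuum and C a set of cut points of M. Define a ternary relation on M: c is between a and b iff c ∈ C and M \ {c} is the union of two disjoint nonempty open sets U, V with a ∈ U and b ∈ V. Then this relation makes M a pretree; that is: (1) if c is between a and b then a ≠ b; (2) c is between a and b iff c is between b and a; (3) if c is between a and b then b is not between a and c; (4) if c is between a and b and c ≠ w, then c is between a and w, or c is between w and b. -/
open Set

universe u v w

open RelHypBoundary Set

/-- Let `M` be a continuum and `C` a set of cut points of `M`.
The betweenness relation `mBtw C a c b` ("`c` is between `a` and `b`") makes
`M` a pretree. -/
theorem mBtw_isPretree {M : Type*} [TopologicalSpace M] [CompactSpace M]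
    [ConnectedSpace M] [TopologicalSpace.MetrizableSpace M]
    (C : Set M) (hC : ∀ c ∈ C, IsCutPoint M c) :
    IsPretree (mBtw C) := by
  refine ⟨?_, ?_, ?_, ?_⟩
  · rintro x y _ ⟨-, U, V, -, -, hd, -, hx, hz⟩ rfl
    exact (hd ▸ mem_inter hx hz : x ∈ (∅ : Set M))
  · rintro x y z ⟨hy, U, V, hU, hV, hd, hc, hx, hz⟩
    exact ⟨hy, V, U, hV, hU, by rwa [inter_comm], by rwa [union_comm], hz, hx⟩
  · rintro x y z ⟨-, U, V, hU, hV, hd, hc, hx, hz⟩ ⟨-, U', V', hU', hV', hd', hc', hx', hy'⟩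
    have mem_or : ∀ t, t ∈ U ∨ t ∈ V ↔ t ≠ y := fun t => Set.ext_iff.1 hc t
    have mem_or' : ∀ t, t ∈ U' ∨ t ∈ V' ↔ t ≠ z := fun t => Set.ext_iff.1 hc' t
    have notMem : ∀ t, t ∈ U → t ∉ V := fun t h h' => (hd ▸ mem_inter h h' : t ∈ (∅ : Set M))
    have notMem' : ∀ t, t ∈ U' → t ∉ V' :=
      fun t h h' => (hd' ▸ mem_inter h h' : t ∈ (∅ : Set M))
    have key : U ∩ U' = Vᶜ ∩ V'ᶜ := by
      ext t
      refine ⟨fun h => ⟨notMem t h.1, notMem' t h.2⟩, fun h => ⟨?_, ?_⟩⟩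
      · exact ((mem_or t).2 fun e => h.2 (e ▸ hy')).resolve_right h.1
      · exact ((mem_or' t).2 fun e => h.1 (e ▸ hz)).resolve_right h.2
    have hclopen : IsClopen (U ∩ U') :=
      ⟨key ▸ hV.isClosed_compl.inter hV'.isClosed_compl, hU.inter hU'⟩
    have huniv := hclopen.eq_univ ⟨x, hx, hx'⟩
    exact notMem z (huniv ▸ mem_univ z : z ∈ U ∩ U').1 hz
  · rintro x y z w ⟨hy, U, V, hU, hV, hd, hc, hx, hz⟩ hw
    have hmem : w ∈ U ∪ V := hc ▸ hw.symm
    rcases hmem with h | h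
    · exact Or.inr ⟨hy, U, V, hU, hV, hd, hc, h, hz⟩
    · exact Or.inl ⟨hy, U, V, hU, hV, hd, hc, hx, h⟩
end

section
/- Let M be a continuum and C a set of cut points of M. Let ℛ be the equivalence relation on M defined by: x ℛ y iff x = y, or x, y ∈ M \ C and no point of C is between x and y. Then the identity of M induces a continuous quotient map q : M/ℛ → D(M,C), and every continuous map from M/ℛ (with the quotient topology) to a Hausdorff topological space factors through q. In particular, if D(M,C) is Hausdorff, then D(M,C) is the maximal Hausdorff quotient of M/ℛ. -/
open Set

universe u v w

open RelHypBoundary Set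

/-- The complement of `c` is the disjoint union of the open sets `U` and `V`. -/
structure CutPair {M : Type u} [TopologicalSpace M] (c : M) (U V : Set M) : Prop where
  isOpen_left : IsOpen U
  isOpen_right : IsOpen V
  inter_eq : U ∩ V = ∅
  union_eq : U ∪ V = ({c}ᶜ : Set M)

namespace CutPair

variable {M : Type u} [TopologicalSpace M] {c d : M} {U V U' V' A : Set M}

theorem swap (h : CutPair c U V) : CutPair c V U :=
  ⟨h.2, h.1, by rw [inter_comm]; exact h.3, by rw [union_comm]; exact h.4⟩

theorem disjoint (h : CutPair c U V) : Disjoint U V := disjoint_iff_inter_eq_empty.2 h.3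

theorem notMem_left (h : CutPair c U V) : c ∉ U := fun hc => by
  have : c ∈ ({c}ᶜ : Set M) := h.4 ▸ Or.inl hc
  exact this rfl

theorem notMem_right (h : CutPair c U V) : c ∉ V := h.swap.notMem_left

theorem notMem_of_mem_left (h : CutPair c U V) {z : M} (hz : z ∈ U) : z ∉ V :=
  fun hz' => h.disjoint.le_bot ⟨hz, hz'⟩

theorem mem_or_mem (h : CutPair c U V) {z : M} (hz : z ≠ c) : z ∈ U ∨ z ∈ V := by
  have : z ∈ U ∪ V := h.4 ▸ hz
  exact this

/-- Collapsing one side of a cut point onto the cut point keeps connected sets connected. -/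
theorem isPreconnected_diff (h : CutPair c U V) (hA : IsPreconnected A)
    (hne : (A \ V).Nonempty) : IsPreconnected (A \ V) := by
  classical
  by_cases hc : c ∈ A
  · let r : M → M := fun z => if z ∈ V then c else z
    have hr : Continuous r := by
      refine continuous_def.2 fun O hO => ?_
      by_cases hcO : c ∈ O
      · have : r ⁻¹' O = V ∪ O := by
          ext z
          by_cases hz : z ∈ V <;> simp [r, hz, hcO]
        rw [this]
        exact h.2.union hO
      · have : r ⁻¹' O = O ∩ U := by
          ext z
          by_cases hz : z ∈ V
          · simp [r, hz, hcO, h.swap.notMem_of_mem_left hz]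
          · simp only [r, mem_preimage, hz, if_false, mem_inter_iff]
            refine ⟨fun hzO => ⟨hzO, ?_⟩, fun hzO => hzO.1⟩
            exact (h.mem_or_mem (fun e => hcO (e ▸ hzO))).resolve_right hz
        rw [this]
        exact hO.inter h.1
    have him : r '' A = A \ V := by
      ext z
      constructor
      · rintro ⟨w, hw, rfl⟩
        by_cases hz : w ∈ V
        · simpa [r, hz] using ⟨hc, h.notMem_right⟩
        · simpa [r, hz] using hw
      · rintro ⟨hz, hzV⟩
        exact ⟨z, hz, by simp [r, hzV]⟩
    rw [← him]
    exact hA.image r hr.continuousOn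
  · obtain ⟨p, hpA, hpV⟩ := hne
    have hsub : A ⊆ U := by
      refine hA.subset_left_of_subset_union h.1 h.2 h.disjoint ?_ ?_
      · rw [h.4]
        exact fun z hz e => hc (e ▸ hz)
      · exact ⟨p, hpA, (h.mem_or_mem (fun e => hc (e ▸ hpA))).resolve_right hpV⟩
    rw [(h.disjoint.mono_left hsub).sdiff_eq_left]
    exact hA

theorem isPreconnected_insert [PreconnectedSpace M] (h : CutPair c U V) :
    IsPreconnected (insert c U) := by
  have : insert c U = univ \ V := by
    ext z
    by_cases hz : z = c
    · simp [hz, h.notMem_right]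
    · have := h.mem_or_mem hz
      have := fun h' => h.notMem_of_mem_left (z := z) h'
      simp only [mem_insert_iff, mem_sdiff, mem_univ]
      tauto
  rw [this]
  exact h.isPreconnected_diff isPreconnected_univ ⟨c, mem_univ _, h.notMem_right⟩

theorem insert_subset [PreconnectedSpace M] (h : CutPair c U V) (h' : CutPair d U' V')
    (hd : d ∈ V) {z : M} (hz : z ∈ insert c U) (hz' : z ∈ U') : insert c U ⊆ U' := by
  refine h.isPreconnected_insert.subset_left_of_subset_union h'.1 h'.2 h'.disjoint ?_ ⟨z, hz, hz'⟩
  rw [h'.4]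
  rintro w (rfl | hw) rfl
  · exact h.notMem_right hd
  · exact h.notMem_of_mem_left hw hd

end CutPair

namespace RelHypBoundary

variable {M : Type u} [TopologicalSpace M] {C : Set M} {x y s t u a b c : M}

theorem mBtw_iff_cutPair :
    mBtw C a c b ↔ c ∈ C ∧ ∃ U V : Set M, CutPair c U V ∧ a ∈ U ∧ b ∈ V := by
  constructor
  · rintro ⟨hc, U, V, h1, h2, h3, h4, ha, hb⟩
    exact ⟨hc, U, V, ⟨h1, h2, h3, h4⟩, ha, hb⟩
  · rintro ⟨hc, U, V, ⟨h1, h2, h3, h4⟩, ha, hb⟩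
    exact ⟨hc, U, V, h1, h2, h3, h4, ha, hb⟩

theorem mBtw.ne_left (hab : mBtw C a c b) : c ≠ a := by
  obtain ⟨-, U, V, h, ha, -⟩ := mBtw_iff_cutPair.1 hab
  rintro rfl
  exact h.notMem_left ha

theorem mBtw.ne_right (hab : mBtw C a c b) : c ≠ b := by
  obtain ⟨-, U, V, h, -, hb⟩ := mBtw_iff_cutPair.1 hab
  rintro rfl
  exact h.notMem_right hb

theorem mBtw_irrefl : ¬ mBtw C a c a := by
  rw [mBtw_iff_cutPair]
  rintro ⟨-, U, V, h, ha, hb⟩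
  exact h.notMem_of_mem_left ha hb

variable [PreconnectedSpace M]

theorem mBtw.trans_right (h : mBtw C x s t) (h' : mBtw C x t u) : mBtw C x s u := by
  obtain ⟨hs, U, V, h, hx, ht⟩ := mBtw_iff_cutPair.1 h
  obtain ⟨-, U', V', h', hx', hu⟩ := mBtw_iff_cutPair.1 h'
  have hsU' : s ∈ U' := h.insert_subset h' ht (Or.inr hx) hx' (mem_insert _ _)
  have hsub := h'.swap.insert_subset h.swap hsU' (mem_insert _ _) ht
  exact mBtw_iff_cutPair.2 ⟨hs, U, V, h, hx, hsub (Or.inr hu)⟩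

theorem mBtw.total (h : mBtw C x s y) (h' : mBtw C x t y) (hst : s ≠ t) :
    mBtw C x s t ∨ mBtw C x t s := by
  obtain ⟨hs, U, V, h, hx, hy⟩ := mBtw_iff_cutPair.1 h
  obtain ⟨ht, U', V', h', hx', hy'⟩ := mBtw_iff_cutPair.1 h'
  rcases h.mem_or_mem hst.symm with htU | htV
  · have := h.swap.insert_subset h'.swap htU (Or.inr hy) hy' (mem_insert _ _)
    exact Or.inr (mBtw_iff_cutPair.2 ⟨ht, U', V', h', hx', this⟩)
  · exact Or.inl (mBtw_iff_cutPair.2 ⟨hs, U, V, h, hx, htV⟩)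

theorem mBtw.not_swap (h : mBtw C x s t) : ¬ mBtw C x t s := by
  intro h'
  obtain ⟨hs, U, V, h, hx, ht⟩ := mBtw_iff_cutPair.1 h
  obtain ⟨-, U', V', h', hx', hs'⟩ := mBtw_iff_cutPair.1 h'
  exact h'.notMem_of_mem_left (h.insert_subset h' ht (Or.inr hx) hx' (mem_insert _ _)) hs'

theorem mBtw.nested (h : mBtw C x a b) (h' : mBtw C a c b) : mBtw C x a c ∧ mBtw C x c b := by
  obtain ⟨ha, U, V, h, hx, hb⟩ := mBtw_iff_cutPair.1 h
  obtain ⟨hc, U', V', h', haU', hb'⟩ := mBtw_iff_cutPair.1 h'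
  have hcV : c ∈ V := h'.swap.insert_subset h.swap haU' (Or.inr hb') hb (mem_insert _ _)
  have hxU' : x ∈ U' := h.insert_subset h' hcV (mem_insert _ _) haU' (Or.inr hx)
  exact ⟨mBtw_iff_cutPair.2 ⟨ha, U, V, h, hx, hcV⟩, mBtw_iff_cutPair.2 ⟨hc, U', V', h', hxU', hb'⟩⟩

end RelHypBoundary

/-- The point `x`, the point `t`, and the points of `C` between them. -/
def cutInterval {M : Type u} [TopologicalSpace M] (C : Set M) (x t : M) : Set M :=
  {s | s = x ∨ s = t ∨ mBtw C x s t}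

section CutInterval

variable {M : Type u} [TopologicalSpace M] {C : Set M} {x y s t a b c : M}

theorem left_mem_cutInterval : x ∈ cutInterval C x t := Or.inl rfl

theorem right_mem_cutInterval : t ∈ cutInterval C x t := Or.inr (Or.inl rfl)

theorem cutInterval_self : cutInterval C x x = {x} := by
  ext s
  simp [cutInterval, mBtw_irrefl]

variable [PreconnectedSpace M]

theorem cutInterval_subset (h : s ∈ cutInterval C x t) :
    cutInterval C x s ⊆ cutInterval C x t := by
  rintro r (rfl | rfl | hr)
  · exact left_mem_cutInterval
  · exact h
  · rcases h with rfl | rfl | h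
    · exact absurd hr mBtw_irrefl
    · exact Or.inr (Or.inr hr)
    · exact Or.inr (Or.inr (hr.trans_right h))

theorem cutInterval_total (hs : s ∈ cutInterval C x y) (ht : t ∈ cutInterval C x y) :
    s ∈ cutInterval C x t ∨ t ∈ cutInterval C x s := by
  by_cases hst : s = t
  · exact Or.inl (Or.inr (Or.inl hst))
  rcases hs with rfl | rfl | hs'
  · exact Or.inl left_mem_cutInterval
  · exact Or.inr ht
  rcases ht with rfl | rfl | ht'
  · exact Or.inr left_mem_cutInterval
  · exact Or.inl (Or.inr (Or.inr hs'))
  · exact (hs'.total ht' hst).imp (fun h => Or.inr (Or.inr h)) (fun h => Or.inr (Or.inr h))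

theorem cutInterval_antisymm (hs : s ∈ cutInterval C x t) (ht : t ∈ cutInterval C x s) :
    s = t := by
  rcases hs with rfl | rfl | hs
  · rw [cutInterval_self] at ht
    exact ht.symm
  · rfl
  rcases ht with rfl | rfl | ht
  · exact absurd hs mBtw_irrefl
  · rfl
  · exact absurd ht hs.not_swap

theorem mem_cutInterval_of_mBtw (h : a ∈ cutInterval C x b) (h' : mBtw C a c b) :
    a ∈ cutInterval C x c ∧ c ∈ cutInterval C x b := by
  rcases h with rfl | rfl | h
  · exact ⟨left_mem_cutInterval, Or.inr (Or.inr h')⟩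
  · exact absurd h' mBtw_irrefl
  · exact ⟨Or.inr (Or.inr (h.nested h').1), Or.inr (Or.inr (h.nested h').2)⟩

end CutInterval

theorem exists_forall_mem_closure {X : Type*} [TopologicalSpace X] [CompactSpace X]
    {ι : Type*} [Nonempty ι] (T : ι → Set X) (hT : Directed (· ⊇ ·) T)
    (hne : ∀ i, (T i).Nonempty) : ∃ p, ∀ i, p ∈ closure (T i) := by
  have := IsCompact.nonempty_iInter_of_directed_nonempty_isCompact_isClosed
    (fun i => closure (T i))
    (fun i j => let ⟨k, hi, hj⟩ := hT i j; ⟨k, closure_mono hi, closure_mono hj⟩)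
    (fun i => (hne i).closure) (fun i => isClosed_closure.isCompact) (fun i => isClosed_closure)
  obtain ⟨p, hp⟩ := this
  exact ⟨p, fun i => mem_iInter.1 hp i⟩

/-- Points not cut off from both `p` and `q` by a point of `C`. -/
def cutCore {M : Type u} [TopologicalSpace M] (C : Set M) (p q : M) : Set M :=
  {z | ∀ c ∈ C, ∀ U V : Set M, CutPair c U V → p ∉ V → q ∉ V → z ∉ V}

section CutCore

variable {M : Type u} [TopologicalSpace M] {C : Set M} {p q : M}

theorem cutPair_notMem_or_notMem (hpq : ¬ ∃ c, mBtw C p c q) {c : M} (hc : c ∈ C) {U V : Set M}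
    (h : CutPair c U V) : (p ∉ U ∧ q ∉ U) ∨ (p ∉ V ∧ q ∉ V) := by
  have h1 : ¬ (p ∈ U ∧ q ∈ V) := fun ⟨hp, hq⟩ =>
    hpq ⟨c, mBtw_iff_cutPair.2 ⟨hc, U, V, h, hp, hq⟩⟩
  have h2 : ¬ (p ∈ V ∧ q ∈ U) := fun ⟨hp, hq⟩ =>
    hpq ⟨c, mBtw_iff_cutPair.2 ⟨hc, V, U, h.swap, hp, hq⟩⟩
  have := h.notMem_of_mem_left (z := p)
  have := h.notMem_of_mem_left (z := q)
  tauto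

theorem cpRel_of_mem_cutCore (hpq : ¬ ∃ c, mBtw C p c q) {s t : M} (hs : s ∈ cutCore C p q)
    (ht : t ∈ cutCore C p q) (hsC : s ∉ C) (htC : t ∉ C) : cpRel C s t := by
  refine Or.inr ⟨hsC, htC, ?_⟩
  rintro ⟨c, hst⟩
  obtain ⟨hc, U, V, h, hsU, htV⟩ := mBtw_iff_cutPair.1 hst
  rcases cutPair_notMem_or_notMem hpq hc h with ⟨hp, hq⟩ | ⟨hp, hq⟩
  · exact hs c hc V U h.swap hp hq hsU
  · exact ht c hc U V h hp hq htV

theorem exists_cutPair_of_isCutPoint [T1Space M] {c : M} (hc : IsCutPoint M c) :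
    ∃ U V : Set M, CutPair c U V ∧ U.Nonempty ∧ V.Nonempty := by
  have ho : IsOpen ({c}ᶜ : Set M) := isOpen_compl_singleton
  unfold IsCutPoint IsPreconnected at hc
  push Not at hc
  obtain ⟨U, V, hU, hV, hUV, hU', hV', he⟩ := hc
  refine ⟨{c}ᶜ ∩ U, {c}ᶜ ∩ V, ⟨ho.inter hU, ho.inter hV, ?_, ?_⟩, hU', hV'⟩
  · rw [← inter_inter_distrib_left]
    exact he
  · rw [← inter_union_distrib_left]
    exact inter_eq_left.2 hUV

theorem countable_cutCore_inter [T1Space M] [PreconnectedSpace M]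
    [TopologicalSpace.SeparableSpace M]
    (hC : ∀ c ∈ C, IsCutPoint M c) (hpq : ¬ ∃ c, mBtw C p c q) :
    (cutCore C p q ∩ C).Countable := by
  have key : ∀ c : M, c ∈ C →
      ∃ U V : Set M, CutPair c U V ∧ V.Nonempty ∧ p ∉ V ∧ q ∉ V := by
    intro c hc
    obtain ⟨U, V, h, hU, hV⟩ := exists_cutPair_of_isCutPoint (hC c hc)
    rcases cutPair_notMem_or_notMem hpq hc h with hn | hn
    · exact ⟨V, U, h.swap, hU, hn⟩
    · exact ⟨U, V, h, hV, hn⟩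
  choose! U V h hV hp hq using key
  refine Set.PairwiseDisjoint.countable_of_isOpen (s := V) ?_
    (fun c hc => (h c hc.2).2) (fun c hc => hV c hc.2)
  intro c hc d hd hcd
  have hcV : c ∉ V d := hc.1 d hd.2 _ _ (h d hd.2) (hp d hd.2) (hq d hd.2)
  have hdV : d ∉ V c := hd.1 c hc.2 _ _ (h c hc.2) (hp c hc.2) (hq c hc.2)
  have hcU : c ∈ U d := ((h d hd.2).mem_or_mem hcd).resolve_right hcV
  have hdU : d ∈ U c := ((h c hc.2).mem_or_mem hcd.symm).resolve_right hdV
  have hsub := (h c hc.2).swap.insert_subset (h d hd.2) hdU (mem_insert _ _) hcU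
  exact (h d hd.2).disjoint.mono_left ((subset_insert _ _).trans hsub)

theorem exists_mem_cutCore_eq [CompactSpace M] [PreconnectedSpace M] {g : M → ℝ}
    (hg : Continuous g) {α : ℝ} (hα : α ∈ Icc (g p) (g q)) :
    ∃ t ∈ cutCore C p q, g t = α := by
  let ι := {P : M × Set M × Set M // P.1 ∈ C ∧ CutPair P.1 P.2.1 P.2.2 ∧ p ∉ P.2.2 ∧ q ∉ P.2.2}
  have hfin : ∀ F : Finset ι, IsPreconnected (⋂ i ∈ F, (i.1.2.2 : Set M)ᶜ) := by
    classical
    intro F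
    induction F using Finset.induction_on with
    | empty => simpa using isPreconnected_univ
    | insert i F hi ih =>
      rw [Finset.set_biInter_insert, inter_comm, ← sdiff_eq]
      refine i.2.2.1.isPreconnected_diff ih ⟨p, ?_, i.2.2.2.1⟩
      exact mem_iInter₂.2 fun j _ => j.2.2.2.1
  have hne := IsCompact.inter_iInter_nonempty
    (isClosed_singleton.preimage hg : IsClosed (g ⁻¹' {α})).isCompact
    (fun i : ι => (i.1.2.2 : Set M)ᶜ) (fun i => i.2.2.1.2.isClosed_compl) (by
      intro F
      obtain ⟨t, ht, hgt⟩ := (hfin F).intermediate_value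
        (mem_iInter₂.2 fun j _ => j.2.2.2.1) (mem_iInter₂.2 fun j _ => j.2.2.2.2)
        hg.continuousOn hα
      exact ⟨t, hgt, ht⟩)
  obtain ⟨t, hgt, ht⟩ := hne
  refine ⟨t, fun c hc U V h hp hq => ?_, hgt⟩
  exact mem_iInter.1 ht ⟨(c, U, V), hc, h, hp, hq⟩

theorem le_of_not_mBtw [CompactSpace M] [PreconnectedSpace M]
    [TopologicalSpace.MetrizableSpace M] (hC : ∀ c ∈ C, IsCutPoint M c) {g : M → ℝ}
    (hg : Continuous g) (hgC : ∀ a b, cpRel C a b → g a = g b) (hpq : ¬ ∃ c, mBtw C p c q) :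
    g q ≤ g p := by
  let := TopologicalSpace.metrizableSpaceMetric M
  by_contra! hlt
  have hcount := (countable_cutCore_inter hC hpq).image g
  have hunc : ¬ (Icc (g p) (g q) \ g '' (cutCore C p q ∩ C)).Countable := by
    intro h
    have : (Icc (g p) (g q)).Countable := (h.union hcount).mono fun z hz => by
      by_cases hz' : z ∈ g '' (cutCore C p q ∩ C)
      · exact Or.inr hz'
      · exact Or.inl ⟨hz, hz'⟩
    exact absurd this (by simpa using hlt)
  have hnt : (Icc (g p) (g q) \ g '' (cutCore C p q ∩ C)).Nontrivial := by
    by_contra hn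
    exact hunc (not_nontrivial_iff.1 hn).countable
  obtain ⟨α, ⟨hα, hαn⟩, β, ⟨hβ, hβn⟩, hne⟩ := hnt
  obtain ⟨s, hs, rfl⟩ := exists_mem_cutCore_eq (C := C) hg hα
  obtain ⟨t, ht, rfl⟩ := exists_mem_cutCore_eq (C := C) hg hβ
  exact hne (hgC s t (cpRel_of_mem_cutCore hpq hs ht
    (fun h => hαn ⟨s, ⟨hs, h⟩, rfl⟩) (fun h => hβn ⟨t, ⟨ht, h⟩, rfl⟩)))

end CutCore

/-- The supremum of `g` on `cutInterval C x t`. -/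
noncomputable def cutSup {M : Type u} [TopologicalSpace M] (C : Set M) (g : M → ℝ) (x t : M) : ℝ :=
  sSup (g '' cutInterval C x t)

section CutSup

variable {M : Type u} [TopologicalSpace M] {C : Set M} {g : M → ℝ} {x y s t : M}

theorem bddAbove_image_of_continuous {X : Type*} [TopologicalSpace X] [CompactSpace X]
    {g : X → ℝ} (hg : Continuous g) (A : Set X) : BddAbove (g '' A) :=
  (isCompact_range hg).bddAbove.mono (image_subset_range g A)

theorem le_cutSup [CompactSpace M] (hg : Continuous g) : g t ≤ cutSup C g x t :=
  le_csSup (bddAbove_image_of_continuous hg _) ⟨t, right_mem_cutInterval, rfl⟩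

theorem cutSup_self : cutSup C g x x = g x := by
  simp [cutSup, cutInterval_self]

variable [CompactSpace M] [PreconnectedSpace M]

theorem cutSup_mono (hg : Continuous g) (h : s ∈ cutInterval C x t) :
    cutSup C g x s ≤ cutSup C g x t :=
  csSup_le_csSup (bddAbove_image_of_continuous hg _) ⟨_, x, left_mem_cutInterval, rfl⟩
    (image_mono (cutInterval_subset h))

theorem exists_cutSup_mem_Ioo [TopologicalSpace.MetrizableSpace M]
    (hC : ∀ c ∈ C, IsCutPoint M c) (hg : Continuous g)
    (hgC : ∀ a b, cpRel C a b → g a = g b) {α β : ℝ} (hα : g x ≤ α) (hαβ : α < β)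
    (hβ : β ≤ g y) : ∃ s ∈ cutInterval C x y, cutSup C g x s ∈ Ioo α β := by
  by_contra! hno
  obtain ⟨γ, hαγ, hγβ⟩ := exists_between hαβ
  let A : Set M := {s | s ∈ cutInterval C x y ∧ cutSup C g x s ≤ α}
  let B : Set M := {s | s ∈ cutInterval C x y ∧ β ≤ cutSup C g x s}
  have hAB : ∀ s ∈ cutInterval C x y, s ∈ A ∨ s ∈ B := by
    intro s hs
    by_cases h : cutSup C g x s ≤ α
    · exact Or.inl ⟨hs, h⟩
    · exact Or.inr ⟨hs, not_lt.1 fun h' => hno s hs ⟨not_le.1 h, h'⟩⟩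
  have hlt : ∀ a ∈ A, ∀ b ∈ B, a ∈ cutInterval C x b := by
    intro a ha b hb
    refine (cutInterval_total ha.1 hb.1).resolve_right fun h => ?_
    have := cutSup_mono hg h
    linarith [ha.2, hb.2]
  have hxA : x ∈ A := ⟨left_mem_cutInterval, cutSup_self.trans_le hα⟩
  have hyB : y ∈ B := ⟨right_mem_cutInterval, hβ.trans (le_cutSup hg)⟩
  have : Nonempty A := ⟨⟨x, hxA⟩⟩
  have : Nonempty B := ⟨⟨y, hyB⟩⟩
  obtain ⟨p, hp⟩ := exists_forall_mem_closure
    (fun c : A => {a | a ∈ A ∧ c.1 ∈ cutInterval C x a})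
    (by
      intro c d
      rcases cutInterval_total c.2.1 d.2.1 with h | h
      · exact ⟨d, fun a ha => ⟨ha.1, cutInterval_subset ha.2 h⟩, fun a ha => ha⟩
      · exact ⟨c, fun a ha => ha, fun a ha => ⟨ha.1, cutInterval_subset ha.2 h⟩⟩)
    (fun c => ⟨c.1, c.2, right_mem_cutInterval⟩)
  obtain ⟨q, hq⟩ := exists_forall_mem_closure
    (fun c : B => {b | (b ∈ B ∧ γ < g b) ∧ b ∈ cutInterval C x c.1})
    (by
      intro c d
      rcases cutInterval_total c.2.1 d.2.1 with h | h
      · exact ⟨c, fun a ha => ha, fun a ha => ⟨ha.1, cutInterval_subset h ha.2⟩⟩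
      · exact ⟨d, fun a ha => ⟨ha.1, cutInterval_subset h ha.2⟩, fun a ha => ha⟩)
    (by
      intro c
      obtain ⟨-, ⟨b, hb, rfl⟩, hγ⟩ := exists_lt_of_lt_csSup
        (⟨_, x, left_mem_cutInterval, rfl⟩ : (g '' cutInterval C x c.1).Nonempty)
        (hγβ.trans_le c.2.2)
      have hby := cutInterval_subset c.2.1 hb
      refine ⟨b, ⟨(hAB b hby).resolve_left fun hbA => ?_, hγ⟩, hb⟩
      have := le_cutSup (C := C) (x := x) (t := b) hg
      linarith [hbA.2])
  have hgp : g p ≤ α := by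
    refine closure_minimal (t := g ⁻¹' Iic α) ?_ (isClosed_Iic.preimage hg) (hp ⟨x, hxA⟩)
    exact fun a ha => (le_cutSup hg).trans ha.1.2
  have hgq : γ ≤ g q :=
    closure_minimal (t := g ⁻¹' Ici γ) (fun a ha => ha.1.2.le) (isClosed_Ici.preimage hg)
      (hq ⟨y, hyB⟩)
  have hsep : ¬ ∃ c, mBtw C p c q := by
    rintro ⟨c, hc⟩
    obtain ⟨hcC, U, V, h, hpU, hqV⟩ := mBtw_iff_cutPair.1 hc
    have hbtw : ∀ a ∈ A, a ∈ U → ∀ b ∈ B, b ∈ V →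
        a ∈ cutInterval C x c ∧ c ∈ cutInterval C x b := fun a ha haU b hb hbV =>
      mem_cutInterval_of_mBtw (hlt a ha b hb) (mBtw_iff_cutPair.2 ⟨hcC, U, V, h, haU, hbV⟩)
    obtain ⟨a, haU, ha, -⟩ := mem_closure_iff.1 (hp ⟨x, hxA⟩) U h.1 hpU
    obtain ⟨b, hbV, ⟨hb, -⟩, -⟩ := mem_closure_iff.1 (hq ⟨y, hyB⟩) V h.2 hqV
    rcases hAB c (cutInterval_subset hb.1 (hbtw a ha haU b hb hbV).2) with hcA | hcB
    · obtain ⟨a', haU', ha', hca⟩ := mem_closure_iff.1 (hp ⟨c, hcA⟩) U h.1 hpU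
      have : c = a' := cutInterval_antisymm hca (hbtw a' ha' haU' b hb hbV).1
      exact h.notMem_left (this ▸ haU')
    · obtain ⟨b', hbV', ⟨hb', -⟩, hbc⟩ := mem_closure_iff.1 (hq ⟨c, hcB⟩) V h.2 hqV
      have : b' = c := cutInterval_antisymm hbc (hbtw a ha haU b' hb' hbV').2
      exact h.notMem_right (this ▸ hbV')
  have := le_of_not_mBtw hC hg hgC hsep
  linarith

theorem not_dRel_of_lt [TopologicalSpace.MetrizableSpace M]
    (hC : ∀ c ∈ C, IsCutPoint M c) (hg : Continuous g)
    (hgC : ∀ a b, cpRel C a b → g a = g b) (hxy : g x < g y) : ¬ dRel C x y := by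
  let D : Set ℝ := {d | (∃ s ∈ cutInterval C x y, cutSup C g x s = d) ∧ d ∈ Ioo (g x) (g y)}
  have hD : ∀ α β : ℝ, g x ≤ α → α < β → β ≤ g y → ∃ d ∈ D, d ∈ Ioo α β := by
    intro α β hα hαβ hβ
    obtain ⟨s, hs, hs'⟩ := exists_cutSup_mem_Ioo hC hg hgC hα hαβ hβ
    exact ⟨_, ⟨⟨s, hs, rfl⟩, hα.trans_lt hs'.1, hs'.2.trans_le hβ⟩, hs'⟩
  have : DenselyOrdered D := ⟨fun a b hab => by
    obtain ⟨d, hd, hd'⟩ := hD a b a.2.2.1.le hab b.2.2.2.le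
    exact ⟨⟨d, hd⟩, hd'.1, hd'.2⟩⟩
  have : Nontrivial D := by
    obtain ⟨d, hd, hd'⟩ := hD _ _ le_rfl hxy le_rfl
    obtain ⟨e, he, he'⟩ := hD _ _ le_rfl hd'.1 hd'.2.le
    exact ⟨⟨⟨d, hd⟩, ⟨e, he⟩, fun h => he'.2.ne' (congrArg Subtype.val h)⟩⟩
  obtain ⟨e⟩ := Order.embedding_from_countable_to_dense ℚ D
  choose s hs hsup using fun d : D => d.2.1
  have hmem : ∀ d : D, mBtw C x (s d) y := by
    intro d
    rcases hs d with h | h | h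
    · have h1 := hsup d
      rw [h, cutSup_self] at h1
      exact absurd h1 d.2.2.1.ne
    · have h1 := hsup d
      have h2 := le_cutSup (C := C) (x := x) (t := y) hg
      rw [h] at h1
      exact absurd (h2.trans_eq h1) d.2.2.2.not_ge
    · exact h
  refine not_not.2 ⟨fun r => s (e r), fun r => ⟨(hmem _).1, hmem _⟩, fun r r' hr => ?_⟩
  have hlt : cutSup C g x (s (e r)) < cutSup C g x (s (e r')) := by
    rw [hsup, hsup]
    exact e.lt_iff_lt.2 hr
  rcases cutInterval_total (hs (e r)) (hs (e r')) with h | h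
  · rcases h with h | h | h
    · exact absurd h (hmem _).ne_left
    · exact absurd hlt (by rw [h]; exact lt_irrefl _)
    · exact h
  · exact absurd (cutSup_mono hg h) hlt.not_ge

end CutSup

theorem eq_of_dRel {M : Type u} [TopologicalSpace M] [CompactSpace M] [ConnectedSpace M]
    [TopologicalSpace.MetrizableSpace M] {C : Set M} (hC : ∀ c ∈ C, IsCutPoint M c)
    {Z : Type v} [TopologicalSpace Z] [T2Space Z] {f : M → Z} (hf : Continuous f)
    (hfC : ∀ a b, cpRel C a b → f a = f b) {x y : M} (h : dRel C x y) : f x = f y := by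
  by_contra hne
  let F : M → range f := rangeFactorization f
  have hF : Continuous F := hf.subtype_mk _
  have : CompactSpace (range f) := isCompact_iff_compactSpace.1 (isCompact_range hf)
  obtain ⟨u, hu0, hu1, -⟩ := exists_continuous_zero_one_of_isClosed
    (isClosed_singleton (x := F x)) (isClosed_singleton (x := F y))
    (disjoint_singleton.2 fun e => hne (congrArg Subtype.val e))
  refine not_dRel_of_lt (g := fun z => u (F z)) hC (u.continuous.comp hF)
    (fun a b hab => congrArg u (Subtype.ext (hfC a b hab))) ?_ h
  rw [hu0 rfl, hu1 rfl]
  exact zero_lt_one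

theorem dRel_of_cpRel {M : Type u} [TopologicalSpace M] {C : Set M} {x y : M}
    (h : cpRel C x y) : dRel C x y := by
  rintro ⟨f, hf, -⟩
  rcases h with rfl | ⟨-, -, h⟩
  · exact mBtw_irrefl (hf 0).2
  · exact h ⟨_, (hf 0).2⟩

/-- The identity of `M` induces a continuous quotient map
`q : M/ℛ → D(M,C)`, and every continuous map from `M/ℛ` to a Hausdorff space
factors through `q`; in particular, if `D(M,C)` is Hausdorff then it is the
maximal Hausdorff quotient of `M/ℛ`. -/
theorem dendrite_maximal_hausdorff_quotient {M : Type u} [TopologicalSpace M]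
    [CompactSpace M] [ConnectedSpace M] [TopologicalSpace.MetrizableSpace M]
    (C : Set M) (hC : ∀ c ∈ C, IsCutPoint M c) :
    ∃ q : Quot (cpRel C) → Quot (dRel C),
      (∀ x : M, q (Quot.mk (cpRel C) x) = Quot.mk (dRel C) x) ∧
      Continuous q ∧
      ∀ (Z : Type v) (_ : TopologicalSpace Z) (_ : T2Space Z)
        (f : Quot (cpRel C) → Z), Continuous f →
          ∃ h : Quot (dRel C) → Z, Continuous h ∧ f = h ∘ q := by
  refine ⟨Quot.map id fun _ _ => dRel_of_cpRel, fun _ => rfl, ?_, ?_⟩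
  · exact continuous_quot_lift _ continuous_quot_mk
  · intro Z _ _ f hf
    have hf' : Continuous fun x => f (Quot.mk (cpRel C) x) := hf.comp continuous_quot_mk
    refine ⟨Quot.lift (fun x => f (Quot.mk _ x)) fun x y hxy =>
      eq_of_dRel hC hf' (fun a b hab => congrArg f (Quot.sound hab)) hxy,
      continuous_quot_lift _ hf', ?_⟩
    funext z
    induction z using Quot.ind
    rfl
end
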